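/- Let d ≥ 3 and c₀ > 0. There exist positive constants c and b (depending only on d and c₀) such that: for all sufficiently large N and every configuration ω_N = (x_1,…,x_N) of N points of 𝕊^d satisfying ‖x_i − x_j‖ ≥ c₀·N^{−1/d} for all i ≠ j, if D(N) is defined by E_G(ω_N) = −D(N)·N^{2−2/d}, then P_G(ω_N) ≤ c·(D(N) − b)·N^{1−2/d}. -/

import Mathlib

open MeasureTheory Finset
open scoped InnerProductSpace

/-- The Euler Beta function `B(a,b) = Γ(a)Γ(b)/Γ(a+b)`. -/
noncomputable def betaFn (a b : ℝ) : ℝ := Real.Gamma a * Real.Gamma b / Real.Gamma (a + b)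

/-- `V_d = 2π^{(d+1)/2}/Γ((d+1)/2)`, the volume of `𝕊^d`. -/
noncomputable def sphereVol (d : ℕ) : ℝ :=
  2 * Real.pi ^ (((d : ℝ) + 1) / 2) / Real.Gamma (((d : ℝ) + 1) / 2)

/-- The Green function of the Laplace–Beltrami operator on `𝕊^d`:
`G(p,q) = g(‖p-q‖)` where
`g(t) = (2/(d·V_d)) Σ_{k≥0} [(d)_k/((d/2+1)_k (k+1))]
  [(1 - t²/4)^{k+1} - B(d/2, d/2+k+1)/B(d/2,d/2)]`. -/
noncomputable def greenKernel (d : ℕ) (p q : EuclideanSpace ℝ (Fin (d + 1))) : ℝ :=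
  (2 / ((d : ℝ) * sphereVol d)) * ∑' k : ℕ,
    ((ascPochhammer ℝ k).eval (d : ℝ) /
        ((ascPochhammer ℝ k).eval ((d : ℝ) / 2 + 1) * ((k : ℝ) + 1))) *
      ((1 - ‖p - q‖ ^ 2 / 4) ^ (k + 1) -
        betaFn ((d : ℝ) / 2) ((d : ℝ) / 2 + (k : ℝ) + 1) / betaFn ((d : ℝ) / 2) ((d : ℝ) / 2))

namespace GreenPol

open Filter Topology
open scoped Pointwise

/-- Ambient space. -/
abbrev EE (d : ℕ) : Type := EuclideanSpace ℝ (Fin (d + 1))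
/-- The unit sphere. -/
abbrev SS (d : ℕ) : Type := Metric.sphere (0 : EuclideanSpace ℝ (Fin (d + 1))) 1

/-- Surface measure, normalized to a probability measure. -/
noncomputable def sig (d : ℕ) : Measure (SS d) :=
  ((volume : Measure (EE d)).toSphere Set.univ)⁻¹ • (volume : Measure (EE d)).toSphere

instance sig_prob (d : ℕ) : IsProbabilityMeasure (sig d) := by
  constructor
  rw [sig, Measure.smul_apply, smul_eq_mul, ENNReal.inv_mul_cancel]
  · rw [Ne, Measure.measure_univ_eq_zero]
    exact Measure.toSphere_ne_zero _
  · exact measure_ne_top _ _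

instance sig_openPos (d : ℕ) : (sig d).IsOpenPosMeasure := by
  constructor
  intro U hU hne h
  rw [sig, Measure.smul_apply, smul_eq_mul, mul_eq_zero] at h
  rcases h with h | h
  · rw [ENNReal.inv_eq_zero] at h
    exact measure_ne_top _ _ h
  · exact hU.measure_ne_zero _ hne h

/-- Action of a linear isometry on the sphere. -/
noncomputable def rot {d : ℕ} (R : EE d ≃ₗᵢ[ℝ] EE d) (p : SS d) : SS d :=
  ⟨R p, by simp⟩

lemma rot_cont {d : ℕ} (R : EE d ≃ₗᵢ[ℝ] EE d) : Continuous (rot R) := by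
  unfold rot
  exact Continuous.subtype_mk (R.continuous.comp continuous_subtype_val) _

lemma map_rot_toSphere {d : ℕ} (R : EE d ≃ₗᵢ[ℝ] EE d) :
    Measure.map (rot R) (volume : Measure (EE d)).toSphere = (volume : Measure (EE d)).toSphere := by
  ext s hs
  have hm : Measurable (rot R) := (rot_cont R).measurable
  rw [Measure.map_apply hm hs, Measure.toSphere_apply' _ hs, Measure.toSphere_apply' _ (hm hs)]
  congr 1
  have hR := R.measurePreserving
  have : (Set.Ioo (0:ℝ) 1 • ((Subtype.val : SS d → EE d) '' (rot R ⁻¹' s)) : Set (EE d)) =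
      R ⁻¹' (Set.Ioo (0:ℝ) 1 • ((Subtype.val : SS d → EE d) '' s)) := by
    ext v
    simp only [Set.mem_smul, Set.mem_image, Set.mem_preimage]
    constructor
    · rintro ⟨t, ht, _, ⟨q, hq, rfl⟩, rfl⟩
      exact ⟨t, ht, _, ⟨rot R q, hq, rfl⟩, by simp [rot]⟩
    · rintro ⟨t, ht, _, ⟨q, hq, rfl⟩, h⟩
      refine ⟨t, ht, _, ⟨rot R.symm q, ?_, rfl⟩, ?_⟩
      · have : rot R (rot R.symm q) = q := by
          apply Subtype.ext; simp [rot]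
        rw [this]; exact hq
      · apply R.injective
        simp [rot, ← h]
  rw [this]
  exact hR.measure_preimage_equiv (f := R.toHomeomorph.toMeasurableEquiv) _

lemma integral_rot {d : ℕ} (R : EE d ≃ₗᵢ[ℝ] EE d) (f : SS d → ℝ) (hf : Continuous f) :
    ∫ p, f (rot R p) ∂(sig d) = ∫ p, f p ∂(sig d) := by
  have h : Measure.map (rot R) (sig d) = sig d := by
    rw [sig, Measure.map_smul, map_rot_toSphere]
  conv_rhs => rw [← h]
  rw [integral_map (rot_cont R).measurable.aemeasurable hf.aestronglyMeasurable]

lemma bdd_of_cont {d : ℕ} (f : SS d → ℝ) (hf : Continuous f) : ∃ C, ∀ p, ‖f p‖ ≤ C := by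
  obtain ⟨C, hC⟩ := (isCompact_univ (X := SS d)).exists_bound_of_continuousOn hf.continuousOn
  exact ⟨C, fun p => hC p trivial⟩

lemma integrable_of_cont {d : ℕ} (f : SS d → ℝ) (hf : Continuous f) : Integrable f (sig d) := by
  obtain ⟨C, hC⟩ := bdd_of_cont f hf
  exact Integrable.of_bound hf.aestronglyMeasurable C (Eventually.of_forall hC)

/-- Integration by parts along a one-parameter rotation group. -/
lemma integral_flow {d : ℕ} (A : EE d →L[ℝ] EE d)
    (hA : ∀ p q : EE d, ⟪A p, q⟫_ℝ = -⟪p, A q⟫_ℝ) (f g : EE d → ℝ)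
    (hf : Continuous (fun p : SS d => f p)) (hg : Continuous (fun p : SS d => g p))
    (H : ∀ γ : ℝ → EE d, (∀ t, ‖γ t‖ = 1) → (∀ t, HasDerivAt γ (A (γ t)) t) →
      ∀ t, HasDerivAt (fun s => f (γ s)) (g (γ t)) t) :
    ∫ p : SS d, g p ∂(sig d) = 0 := by
  have hskew : A ∈ skewAdjoint (EE d →L[ℝ] EE d) := by
    rw [skewAdjoint.mem_iff, ContinuousLinearMap.star_eq_adjoint]
    ext1 p
    apply ext_inner_right ℝ
    intro q
    rw [ContinuousLinearMap.adjoint_inner_left, neg_apply, inner_neg_left, hA,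
      neg_neg]
  let : NormedAlgebra ℚ (EE d →L[ℝ] EE d) := NormedAlgebra.restrictScalars ℚ ℝ _
  have hmem : ∀ t : ℝ, NormedSpace.exp (t • A) ∈ unitary (EE d →L[ℝ] EE d) := fun t =>
    NormedSpace.exp_mem_unitary_of_mem_skewAdjoint (skewAdjoint.smul_mem t hskew)
  let R : ℝ → (EE d ≃ₗᵢ[ℝ] EE d) := fun t => Unitary.linearIsometryEquiv ⟨_, hmem t⟩
  have hR : ∀ t (p : EE d), R t p = NormedSpace.exp (t • A) p := fun t p => rfl
  have hd : ∀ (p : EE d) t, HasDerivAt (fun s => R s p) (A (R t p)) t := by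
    intro p t
    have := (hasDerivAt_exp_smul_const' (𝕂 := ℝ) A t).clm_apply (hasDerivAt_const t p)
    simpa [hR] using this
  have hd2 : ∀ (p : SS d) t, HasDerivAt (fun s => f (R s p)) (g (R t p)) t := by
    intro p t
    exact H (fun s => R s p) (fun s => by simp) (hd p) t
  obtain ⟨C, hC⟩ := bdd_of_cont _ hg
  have key := hasDerivAt_integral_of_dominated_loc_of_deriv_le (μ := sig d) (x₀ := (0:ℝ))
    (s := Set.univ) (F := fun t (p : SS d) => f (R t p)) (F' := fun t (p : SS d) => g (R t p))
    (bound := fun _ => C) univ_mem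
    (Eventually.of_forall fun t => (hf.comp (rot_cont (R t))).aestronglyMeasurable)
    (integrable_of_cont _ (hf.comp (rot_cont (R 0))))
    (hg.comp (rot_cont (R 0))).aestronglyMeasurable
    (Eventually.of_forall fun p t _ => hC (rot (R t) p))
    (integrable_const _)
    (Eventually.of_forall fun p t _ => hd2 p t)
  have h2 := key.2
  have hconst : (fun t => ∫ p : SS d, f (R t p) ∂(sig d)) = fun _ => ∫ p : SS d, f p ∂(sig d) := by
    funext t
    exact integral_rot (R t) _ hf
  rw [hconst] at h2
  have h3 := h2.unique (hasDerivAt_const _ _)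
  rw [← h3]
  exact (integral_rot (R 0) _ hg).symm

end GreenPol

namespace GreenPol

open Filter Topology

/-- The variable `u = (1 + ⟪p,x⟫)/2`. -/
noncomputable def uu {d : ℕ} (p x : EE d) : ℝ := (1 + ⟪p, x⟫_ℝ) / 2

lemma uu_comm {d : ℕ} (p x : EE d) : uu p x = uu x p := by
  unfold uu; rw [real_inner_comm]

lemma uu_mem {d : ℕ} {p x : EE d} (hp : ‖p‖ = 1) (hx : ‖x‖ = 1) : uu p x ∈ Set.Icc (0:ℝ) 1 := by
  have h := abs_real_inner_le_norm p x
  rw [hp, hx, mul_one, abs_le] at h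
  unfold uu
  constructor <;> linarith [h.1, h.2]

lemma ss_norm {d : ℕ} (p : SS d) : ‖(p : EE d)‖ = 1 := by simp

lemma uu_mem' {d : ℕ} (p x : SS d) : uu (p : EE d) x ∈ Set.Icc (0:ℝ) 1 :=
  uu_mem (ss_norm p) (ss_norm x)

lemma uu_eq {d : ℕ} {p x : EE d} (hp : ‖p‖ = 1) (hx : ‖x‖ = 1) :
    1 - ‖p - x‖ ^ 2 / 4 = uu p x := by
  rw [norm_sub_sq_real, hp, hx]; unfold uu; ring

lemma uu_self {d : ℕ} (p : SS d) : uu (p : EE d) p = 1 := by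
  rw [← uu_eq (ss_norm p) (ss_norm p)]; simp

lemma uu_cont {d : ℕ} (x : EE d) : Continuous (fun p : SS d => uu (p : EE d) x) := by
  unfold uu; fun_prop

lemma comp_uu_cont {d : ℕ} (x : SS d) {h : ℝ → ℝ} (hh : ContinuousOn h (Set.Icc 0 1)) :
    Continuous (fun p : SS d => h (uu (p : EE d) x)) :=
  hh.comp_continuous (uu_cont _) (fun p => uu_mem' p x)

lemma integral_gz {d : ℕ} (x y : SS d) (z : EE d) (h h' k' k'' : ℝ → ℝ)
    (hh : ∀ u ∈ Set.Icc (0:ℝ) 1, HasDerivAt h (h' u) u)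
    (hh' : ContinuousOn h' (Set.Icc 0 1))
    (hk : ∀ u ∈ Set.Icc (0:ℝ) 1, HasDerivAt k' (k'' u) u)
    (hk' : ContinuousOn k'' (Set.Icc 0 1)) :
    ∫ p : SS d, ((h' (uu (p : EE d) y) * ((⟪(p : EE d), z⟫_ℝ * ⟪(x : EE d), y⟫_ℝ
        - ⟪(p : EE d), x⟫_ℝ * ⟪z, y⟫_ℝ) / 2) * k' (uu (p : EE d) x)
      + h (uu (p : EE d) y) * (k'' (uu (p : EE d) x) * ((⟪(p : EE d), z⟫_ℝ
        - ⟪(p : EE d), x⟫_ℝ * ⟪z, x⟫_ℝ) / 2))) * ⟪(p : EE d), z⟫_ℝ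
      + h (uu (p : EE d) y) * k' (uu (p : EE d) x) *
        (⟪(p : EE d), z⟫_ℝ * ⟪(x : EE d), z⟫_ℝ - ⟪(p : EE d), x⟫_ℝ * ⟪z, z⟫_ℝ)) ∂(sig d) = 0 := by
  have ch : ContinuousOn h (Set.Icc 0 1) := fun u hu => (hh u hu).continuousAt.continuousWithinAt
  have ck : ContinuousOn k' (Set.Icc 0 1) := fun u hu => (hk u hu).continuousAt.continuousWithinAt
  let A : EE d →L[ℝ] EE d := (innerSL ℝ z).smulRight (x : EE d) - (innerSL ℝ (x : EE d)).smulRight z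
  have hA : ∀ p, A p = ⟪z, p⟫_ℝ • (x : EE d) - ⟪(x : EE d), p⟫_ℝ • z := fun p => by simp [A]
  have c1 := comp_uu_cont y ch
  have c2 := comp_uu_cont y hh'
  have c3 := comp_uu_cont x ck
  have c4 := comp_uu_cont x hk'
  refine integral_flow A ?_ (fun p => h (uu p y) * k' (uu p x) * ⟪p, z⟫_ℝ) (fun p =>
      (h' (uu p y) * ((⟪p, z⟫_ℝ * ⟪(x : EE d), y⟫_ℝ - ⟪p, x⟫_ℝ * ⟪z, y⟫_ℝ) / 2) * k' (uu p x)
      + h (uu p y) * (k'' (uu p x) * ((⟪p, z⟫_ℝ - ⟪p, x⟫_ℝ * ⟪z, x⟫_ℝ) / 2))) * ⟪p, z⟫_ℝ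
      + h (uu p y) * k' (uu p x) * (⟪p, z⟫_ℝ * ⟪(x : EE d), z⟫_ℝ - ⟪p, x⟫_ℝ * ⟪z, z⟫_ℝ)) ?_ ?_ ?_
  · intro p q
    rw [hA, hA, inner_sub_left, inner_sub_right, inner_smul_left, inner_smul_left,
      inner_smul_right, inner_smul_right, real_inner_comm p x, real_inner_comm p z]
    simp only [conj_trivial]; ring
  · repeat' first | exact c1 | exact c2 | exact c3 | exact c4 | exact uu_cont _ | apply Continuous.add | apply Continuous.sub | apply Continuous.mul | apply Continuous.div_const | fun_prop
  · repeat' first | exact c1 | exact c2 | exact c3 | exact c4 | exact uu_cont _ | apply Continuous.add | apply Continuous.sub | apply Continuous.mul | apply Continuous.div_const | fun_prop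
  · intro γ hγ hγ' t
    have hi : ∀ w : EE d, HasDerivAt (fun s => ⟪γ s, w⟫_ℝ)
        (⟪γ t, z⟫_ℝ * ⟪(x : EE d), w⟫_ℝ - ⟪γ t, x⟫_ℝ * ⟪z, w⟫_ℝ) t := by
      intro w
      have := (hγ' t).inner ℝ (hasDerivAt_const t w)
      convert! this using 1
      rw [hA, inner_sub_left, inner_smul_left, inner_smul_left, real_inner_comm (γ t) z,
        real_inner_comm (γ t) (x : EE d)]
      simp
    have hu : ∀ w : EE d, HasDerivAt (fun s => uu (γ s) w)
        ((⟪γ t, z⟫_ℝ * ⟪(x : EE d), w⟫_ℝ - ⟪γ t, x⟫_ℝ * ⟪z, w⟫_ℝ) / 2) t := by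
      intro w
      exact ((hi w).const_add 1).div_const 2
    have h1 : HasDerivAt (fun s => h (uu (γ s) y)) _ t :=
      (hh _ (uu_mem (hγ t) (ss_norm y))).comp t (hu y)
    have h2 : HasDerivAt (fun s => k' (uu (γ s) x)) _ t :=
      (hk _ (uu_mem (hγ t) (ss_norm x))).comp t (hu x)
    have h3 := (h1.mul h2).mul (hi z)
    convert! h3 using 1
    have : ⟪(x : EE d), x⟫_ℝ = 1 := by rw [real_inner_self_eq_norm_sq]; simp
    simp only [Pi.mul_apply]
    rw [this]; ring

/-- First Green identity for zonal functions. -/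
lemma green_first {d : ℕ} (x y : SS d) (h h' k' k'' : ℝ → ℝ)
    (hh : ∀ u ∈ Set.Icc (0:ℝ) 1, HasDerivAt h (h' u) u)
    (hh' : ContinuousOn h' (Set.Icc 0 1))
    (hk : ∀ u ∈ Set.Icc (0:ℝ) 1, HasDerivAt k' (k'' u) u)
    (hk' : ContinuousOn k'' (Set.Icc 0 1)) :
    ∫ p : SS d, h (uu (p : EE d) y) * (uu (p : EE d) x * (1 - uu (p : EE d) x) * k'' (uu (p : EE d) x)
      + (d : ℝ) / 2 * (1 - 2 * uu (p : EE d) x) * k' (uu (p : EE d) x)) ∂(sig d) =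
    - ∫ p : SS d, h' (uu (p : EE d) y) * k' (uu (p : EE d) x) *
      ((⟪(x : EE d), y⟫_ℝ - ⟪(p : EE d), x⟫_ℝ * ⟪(p : EE d), y⟫_ℝ) / 4) ∂(sig d) := by
  have ch : ContinuousOn h (Set.Icc 0 1) := fun u hu => (hh u hu).continuousAt.continuousWithinAt
  have ck : ContinuousOn k' (Set.Icc 0 1) := fun u hu => (hk u hu).continuousAt.continuousWithinAt
  have c1 := comp_uu_cont y ch
  have c2 := comp_uu_cont y hh'
  have c3 := comp_uu_cont x ck
  have c4 := comp_uu_cont x hk'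
  have c5 := uu_cont (x : EE d)
  let e := EuclideanSpace.basisFun (Fin (d+1)) ℝ
  have hz := fun i => integral_gz x y (e i) h h' k' k'' hh hh' hk hk'
  have hs := Finset.sum_eq_zero (s := Finset.univ) (fun i _ => hz i)
  rw [← integral_finsetSum] at hs
  swap
  · intro i _
    apply integrable_of_cont
    repeat' first | exact c1 | exact c2 | exact c3 | exact c4 | exact uu_cont _ | apply Continuous.add | apply Continuous.sub | apply Continuous.mul | apply Continuous.div_const | fun_prop
  rw [eq_neg_iff_add_eq_zero, ← integral_add]
  rotate_left
  · apply integrable_of_cont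
    repeat' first | exact c1 | exact c2 | exact c3 | exact c4 | exact uu_cont _ | apply Continuous.add | apply Continuous.sub | apply Continuous.mul | apply Continuous.div_const | fun_prop
  · apply integrable_of_cont
    repeat' first | exact c1 | exact c2 | exact c3 | exact c4 | exact uu_cont _ | apply Continuous.add | apply Continuous.sub | apply Continuous.mul | apply Continuous.div_const | fun_prop
  rw [← mul_right_inj' (two_ne_zero (α := ℝ)), mul_zero, ← hs, ← integral_const_mul]
  congr 1
  funext p
  have key : ∀ a b : EE d, ∑ i, ⟪a, e i⟫_ℝ * ⟪e i, b⟫_ℝ = ⟪a, b⟫_ℝ :=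
    fun a b => e.sum_inner_mul_inner a b
  have hpp : ⟪(p : EE d), p⟫_ℝ = 1 := by rw [real_inner_self_eq_norm_sq]; simp
  have s1 : ∑ i, ⟪(p : EE d), e i⟫_ℝ * ⟪(p : EE d), e i⟫_ℝ = 1 := by
    refine Eq.trans ?_ hpp
    refine Eq.trans ?_ (key p p)
    exact Finset.sum_congr rfl fun i _ => by rw [real_inner_comm (p : EE d) (e i)]
  have s2 := key p y
  have s3 := key p x
  have s4 : ∑ i, ⟪e i, e i⟫_ℝ = (d : ℝ) + 1 := by
    simp
  have hux : ⟪(p : EE d), x⟫_ℝ = 2 * uu (p : EE d) x - 1 := by unfold uu; ring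
  calc _ = (h' (uu (p : EE d) y) * k' (uu (p : EE d) x) * ⟪(x : EE d), y⟫_ℝ / 2
        + h (uu (p : EE d) y) * k'' (uu (p : EE d) x) / 2) * 1
      - h' (uu (p : EE d) y) * k' (uu (p : EE d) x) * ⟪(p : EE d), x⟫_ℝ / 2 * ⟪(p : EE d), y⟫_ℝ
      + (h (uu (p : EE d) y) * k' (uu (p : EE d) x)
        - h (uu (p : EE d) y) * k'' (uu (p : EE d) x) * ⟪(p : EE d), x⟫_ℝ / 2) * ⟪(p : EE d), x⟫_ℝ
      - h (uu (p : EE d) y) * k' (uu (p : EE d) x) * ⟪(p : EE d), x⟫_ℝ * ((d : ℝ) + 1) := by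
        rw [hux]; ring
    _ = _ := by
        symm
        calc _ = ∑ i, ((h' (uu (p : EE d) y) * k' (uu (p : EE d) x) * ⟪(x : EE d), y⟫_ℝ / 2
        + h (uu (p : EE d) y) * k'' (uu (p : EE d) x) / 2) * (⟪(p : EE d), e i⟫_ℝ * ⟪(p : EE d), e i⟫_ℝ)
      - h' (uu (p : EE d) y) * k' (uu (p : EE d) x) * ⟪(p : EE d), x⟫_ℝ / 2 *
          (⟪(p : EE d), e i⟫_ℝ * ⟪e i, (y : EE d)⟫_ℝ)
      + (h (uu (p : EE d) y) * k' (uu (p : EE d) x)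
        - h (uu (p : EE d) y) * k'' (uu (p : EE d) x) * ⟪(p : EE d), x⟫_ℝ / 2) *
          (⟪(p : EE d), e i⟫_ℝ * ⟪e i, (x : EE d)⟫_ℝ)
      - h (uu (p : EE d) y) * k' (uu (p : EE d) x) * ⟪(p : EE d), x⟫_ℝ * ⟪e i, e i⟫_ℝ) := by
              refine Finset.sum_congr rfl fun i _ => ?_
              rw [real_inner_comm (x : EE d) (e i)]
              ring
          _ = _ := by
              simp only [Finset.sum_sub_distrib, Finset.sum_add_distrib, ← Finset.mul_sum, s1, s2, s3,
                s4]

/-- Second Green identity: self-adjointness of the Laplacian on zonal functions. -/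
lemma green_second {d : ℕ} (x y : SS d) (h h' h'' k k' k'' : ℝ → ℝ)
    (hh : ∀ u ∈ Set.Icc (0:ℝ) 1, HasDerivAt h (h' u) u)
    (hh' : ∀ u ∈ Set.Icc (0:ℝ) 1, HasDerivAt h' (h'' u) u)
    (hh'' : ContinuousOn h'' (Set.Icc 0 1))
    (hk : ∀ u ∈ Set.Icc (0:ℝ) 1, HasDerivAt k (k' u) u)
    (hk' : ∀ u ∈ Set.Icc (0:ℝ) 1, HasDerivAt k' (k'' u) u)
    (hk'' : ContinuousOn k'' (Set.Icc 0 1)) :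
    ∫ p : SS d, h (uu (p : EE d) y) * (uu (p : EE d) x * (1 - uu (p : EE d) x) * k'' (uu (p : EE d) x)
      + (d : ℝ) / 2 * (1 - 2 * uu (p : EE d) x) * k' (uu (p : EE d) x)) ∂(sig d) =
    ∫ p : SS d, k (uu (p : EE d) x) * (uu (p : EE d) y * (1 - uu (p : EE d) y) * h'' (uu (p : EE d) y)
      + (d : ℝ) / 2 * (1 - 2 * uu (p : EE d) y) * h' (uu (p : EE d) y)) ∂(sig d) := by
  have ch : ContinuousOn h' (Set.Icc 0 1) := fun u hu => (hh' u hu).continuousAt.continuousWithinAt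
  have ck : ContinuousOn k' (Set.Icc 0 1) := fun u hu => (hk' u hu).continuousAt.continuousWithinAt
  rw [green_first x y h h' k' k'' hh ch hk' hk'', green_first y x k k' h' h'' hk ck hh' hh'']
  congr 2
  funext p
  rw [real_inner_comm (x : EE d) y]
  ring

end GreenPol

namespace GreenPol

open Filter Topology

/-- Series coefficients. -/
noncomputable def aa (d k : ℕ) : ℝ :=
  (ascPochhammer ℝ k).eval (d : ℝ) /
        ((ascPochhammer ℝ k).eval ((d : ℝ) / 2 + 1) * ((k : ℝ) + 1))

/-- Moments of `u`. -/
noncomputable def mm (d k : ℕ) : ℝ :=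
  betaFn ((d : ℝ) / 2) ((d : ℝ) / 2 + (k : ℝ) + 1) / betaFn ((d : ℝ) / 2) ((d : ℝ) / 2)

/-- Green function up to normalization. -/
noncomputable def Gt (d : ℕ) (u : ℝ) : ℝ := ∑' k : ℕ, aa d k * (u ^ (k + 1) - mm d k)

lemma aa_pos {d : ℕ} (hd : 3 ≤ d) (k : ℕ) : 0 < aa d k := by
  have h : (0:ℝ) < d := by exact_mod_cast (by omega)
  have h1 := ascPochhammer_pos k (d : ℝ) h
  have h2 := ascPochhammer_pos k ((d : ℝ) / 2 + 1) (by positivity)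
  unfold aa
  positivity

lemma aa_zero (d : ℕ) : aa d 0 = 1 := by simp [aa]

lemma aa_succ {d : ℕ} (hd : 3 ≤ d) (k : ℕ) :
    aa d (k + 1) * (((d : ℝ) / 2 + 1 + k) * (k + 2)) = aa d k * ((d + k) * (k + 1)) := by
  have h : (0:ℝ) < d := by exact_mod_cast (by omega)
  have h2 := ascPochhammer_pos k ((d : ℝ) / 2 + 1) (by positivity)
  unfold aa
  rw [ascPochhammer_succ_eval, ascPochhammer_succ_eval]
  have h3 : (0:ℝ) < (d : ℝ) / 2 + 1 + k := by positivity
  push_cast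
  field_simp
  ring

lemma betaFn_pos {a b : ℝ} (ha : 0 < a) (hb : 0 < b) : 0 < betaFn a b := by
  unfold betaFn
  have := Real.Gamma_pos_of_pos ha
  have := Real.Gamma_pos_of_pos hb
  have := Real.Gamma_pos_of_pos (add_pos ha hb)
  positivity

lemma betaFn_succ {a b : ℝ} (ha : 0 < a) (hb : 0 < b) :
    betaFn a (b + 1) * (a + b) = betaFn a b * b := by
  unfold betaFn
  rw [Real.Gamma_add_one hb.ne', ← add_assoc, Real.Gamma_add_one (by positivity)]
  have := Real.Gamma_pos_of_pos (add_pos ha hb)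
  field_simp

lemma mm_zero {d : ℕ} (hd : 3 ≤ d) : mm d 0 = 1 / 2 := by
  have h : (0:ℝ) < d := by exact_mod_cast (by omega)
  have h1 := betaFn_succ (a := (d:ℝ)/2) (b := (d:ℝ)/2) (by positivity) (by positivity)
  have h2 := betaFn_pos (a := (d:ℝ)/2) (b := (d:ℝ)/2) (by positivity) (by positivity)
  unfold mm
  simp only [Nat.cast_zero, add_zero]
  rw [div_eq_iff h2.ne']
  have h3 : (d:ℝ)/2 + d/2 = d := by ring
  rw [h3] at h1
  have := mul_right_cancel₀ (b := (d:ℝ)) h.ne' (a := betaFn ((d:ℝ)/2) ((d:ℝ)/2 + 1))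
    (c := 1/2 * betaFn ((d:ℝ)/2) ((d:ℝ)/2)) (by linarith)
  exact this

lemma mm_succ {d : ℕ} (hd : 3 ≤ d) (k : ℕ) :
    mm d (k + 1) * (d + k + 1) = mm d k * ((d : ℝ) / 2 + k + 1) := by
  have h : (0:ℝ) < d := by exact_mod_cast (by omega)
  have h1 := betaFn_succ (a := (d:ℝ)/2) (b := (d:ℝ)/2 + k + 1) (by positivity) (by positivity)
  unfold mm
  push_cast
  rw [div_mul_eq_mul_div, div_mul_eq_mul_div]
  congr 1
  rw [← h1]
  ring_nf

lemma aa_mm {d : ℕ} (hd : 3 ≤ d) (k : ℕ) :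
    aa d k * mm d k * ((k + 1) * (d + k)) = (d : ℝ) / 2 := by
  have h : (0:ℝ) < d := by exact_mod_cast (by omega)
  induction k with
  | zero => rw [aa_zero, mm_zero hd]; push_cast; ring
  | succ k ih =>
    have h1 := aa_succ hd k
    have h2 := mm_succ hd k
    have h3 : (0:ℝ) < (d : ℝ) / 2 + 1 + k := by positivity
    push_cast
    apply mul_right_cancel₀ h3.ne'
    calc _ = (aa d (k + 1) * (((d : ℝ) / 2 + 1 + k) * (k + 2))) * (mm d (k + 1) * (d + k + 1)) := by
            ring
      _ = (aa d k * mm d k * ((k + 1) * (d + k))) * ((d : ℝ) / 2 + 1 + k) := by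
            rw [h1, h2]; ring
      _ = _ := by rw [ih]

lemma mm_pos {d : ℕ} (hd : 3 ≤ d) (k : ℕ) : 0 < mm d k := by
  have h : (0:ℝ) < d := by exact_mod_cast (by omega)
  exact div_pos (betaFn_pos (by positivity) (by positivity))
    (betaFn_pos (by positivity) (by positivity))

lemma aa_ge {d : ℕ} (hd : 3 ≤ d) (k : ℕ) : 1 ≤ aa d k * (k + 1) := by
  induction k with
  | zero => rw [aa_zero]; simp
  | succ k ih =>
    have h : (3:ℝ) ≤ d := by exact_mod_cast hd
    have h1 := aa_succ hd k
    have h3 : (0:ℝ) < (d : ℝ) / 2 + 1 + k := by positivity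
    push_cast
    have : (aa d k * (k + 1)) * (d + k) ≥ 1 * (d / 2 + 1 + k) := by
      apply mul_le_mul ih (by linarith) h3.le (by linarith)
    by_contra hlt
    push Not at hlt
    have := mul_lt_mul_of_pos_right hlt h3
    nlinarith

lemma mm_le {d : ℕ} (hd : 3 ≤ d) (k : ℕ) : mm d k ≤ ((d : ℝ) / 2) / (d + k) := by
  have h : (0:ℝ) < d := by exact_mod_cast (by omega)
  have h0 : (0:ℝ) < d + k := by positivity
  rw [le_div_iff₀ h0, ← aa_mm hd k]
  have h1 := aa_ge hd k
  have h2 := mm_pos hd k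
  have : mm d k * (d + k) * 1 ≤ mm d k * (d + k) * (aa d k * (k + 1)) := by
    gcongr
  nlinarith

lemma summable_aa_mm {d : ℕ} (hd : 3 ≤ d) : Summable (fun k => aa d k * mm d k) := by
  have h : (3:ℝ) ≤ d := by exact_mod_cast hd
  have h1 : Summable (fun k : ℕ => (d : ℝ) / 2 * (1 / ((k + 1 : ℕ) : ℝ) ^ 2)) := by
    apply Summable.mul_left
    exact (summable_nat_add_iff 1).2 (Real.summable_one_div_nat_pow.2 one_lt_two)
  refine Summable.of_nonneg_of_le (fun k => (mul_pos (aa_pos hd k) (mm_pos hd k)).le) (fun k => ?_) h1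
  rw [mul_one_div, le_div_iff₀ (by positivity), ← aa_mm hd k]
  have := mul_pos (aa_pos hd k) (mm_pos hd k)
  apply mul_le_mul_of_nonneg_left _ this.le
  push_cast
  nlinarith [(Nat.cast_nonneg k : (0:ℝ) ≤ k)]

lemma hasDerivAt_pow1 (k : ℕ) (u : ℝ) :
    HasDerivAt (fun v : ℝ => v ^ (k + 1)) (((k : ℝ) + 1) * u ^ k) u := by
  have := hasDerivAt_pow (k + 1) u
  simpa using this

lemma moment {d : ℕ} (hd : 3 ≤ d) (y : SS d) (k : ℕ) :
    ∫ p : SS d, uu (p : EE d) y ^ (k + 1) ∂(sig d) = mm d k := by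
  have h : (3:ℝ) ≤ d := by exact_mod_cast hd
  have hrec : ∀ k : ℕ, (∫ p : SS d, uu (p : EE d) y ^ (k + 1) ∂(sig d)) * (d + k) =
      (∫ p : SS d, uu (p : EE d) y ^ k ∂(sig d)) * ((d:ℝ) / 2 + k) := by
    intro k
    have key := green_first y y (fun _ => 1) (fun _ => 0) (fun u => u ^ k)
      (fun u => (k : ℝ) * u ^ (k - 1)) (fun u _ => hasDerivAt_const u 1) continuousOn_const
      (fun u _ => hasDerivAt_pow k u) (by fun_prop)
    simp only [zero_mul, integral_zero, neg_zero, one_mul] at key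
    have c := uu_cont (y : EE d)
    have e : ∀ p : SS d, uu (p : EE d) y * (1 - uu (p : EE d) y) * ((k : ℝ) * uu (p : EE d) y ^ (k - 1)) +
        (d : ℝ) / 2 * (1 - 2 * uu (p : EE d) y) * uu (p : EE d) y ^ k =
        uu (p : EE d) y ^ k * ((d:ℝ) / 2 + k) - uu (p : EE d) y ^ (k + 1) * (d + k) := by
      intro p
      cases k with
      | zero => simp; ring
      | succ k => simp only [Nat.add_sub_cancel]; push_cast; ring
    simp only [e] at key
    rw [integral_sub, integral_mul_const, integral_mul_const] at key
    · linarith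
    · exact integrable_of_cont _ (by fun_prop)
    · exact integrable_of_cont _ (by fun_prop)
  induction k with
  | zero =>
    have := hrec 0
    simp at this
    rw [mm_zero hd]
    simp only [zero_add, pow_one]
    apply mul_right_cancel₀ (b := (d:ℝ)) (by linarith)
    linarith
  | succ k ih =>
    have h1 := hrec (k + 1)
    have h2 := mm_succ hd k
    rw [ih] at h1
    push_cast at h1
    have h0 : (0:ℝ) < d + k + 1 := by positivity
    apply mul_right_cancel₀ h0.ne'
    rw [h2]
    linarith

/-- The coefficient of the approximate identity. -/
noncomputable def tau (d k : ℕ) : ℝ := aa d k * (k + 1) * (k + (d : ℝ) / 2)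

lemma tau_succ {d : ℕ} (hd : 3 ≤ d) (k : ℕ) : tau d (k + 1) = aa d k * (k + 1) * (k + d) := by
  have := aa_succ hd k
  unfold tau; push_cast; linarith

lemma tau_mm {d : ℕ} (hd : 3 ≤ d) (k : ℕ) : tau d (k + 1) * mm d k = (d:ℝ) / 2 := by
  rw [tau_succ hd, ← aa_mm hd k]; ring

/-- Partial sums. -/
noncomputable def Pn (d n : ℕ) (u : ℝ) : ℝ := ∑ k ∈ Finset.range n, aa d k * (u ^ (k + 1) - mm d k)
/-- Derivative of partial sums. -/
noncomputable def Pn1 (d n : ℕ) (u : ℝ) : ℝ := ∑ k ∈ Finset.range n, aa d k * ((k + 1) * u ^ k)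
/-- Second derivative of partial sums. -/
noncomputable def Pn2 (d n : ℕ) (u : ℝ) : ℝ :=
  ∑ k ∈ Finset.range n, aa d k * ((k + 1) * (k * u ^ (k - 1)))

lemma Pn_deriv (d n : ℕ) (u : ℝ) : HasDerivAt (Pn d n) (Pn1 d n u) u := by
  unfold Pn Pn1
  exact HasDerivAt.fun_sum fun k _ => ((hasDerivAt_pow1 k u).sub_const _).const_mul _

lemma Pn1_deriv (d n : ℕ) (u : ℝ) : HasDerivAt (Pn1 d n) (Pn2 d n u) u := by
  unfold Pn1 Pn2
  exact HasDerivAt.fun_sum fun k _ => ((hasDerivAt_pow k u).const_mul _).const_mul _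

lemma Pn_lap {d : ℕ} (hd : 3 ≤ d) (n : ℕ) (u : ℝ) :
    u * (1 - u) * Pn2 d n u + (d:ℝ) / 2 * (1 - 2 * u) * Pn1 d n u = (d:ℝ) / 2 - tau d n * u ^ n := by
  induction n with
  | zero => simp [Pn1, Pn2, tau, aa_zero]
  | succ n ih =>
    unfold Pn1 Pn2 at *
    rw [Finset.sum_range_succ, Finset.sum_range_succ, mul_add, mul_add, tau_succ hd]
    have e : u * (1 - u) * (aa d n * ((n + 1) * (n * u ^ (n - 1)))) +
        (d:ℝ) / 2 * (1 - 2 * u) * (aa d n * ((n + 1) * u ^ n)) =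
        tau d n * u ^ n - aa d n * (n + 1) * (n + d) * u ^ (n + 1) := by
      unfold tau
      cases n with
      | zero => simp; ring
      | succ k => simp only [Nat.add_sub_cancel]; push_cast; ring
    linarith

lemma uu_lt {d : ℕ} (y p : SS d) (h : p ≠ y) : uu (p : EE d) y < 1 := by
  rw [← uu_eq (ss_norm p) (ss_norm y)]
  have : 0 < ‖(p : EE d) - y‖ := by
    rw [norm_pos_iff, sub_ne_zero]
    exact fun hh => h (Subtype.ext hh)
  have := pow_pos this 2
  linarith

lemma approx_id {d : ℕ} (hd : 3 ≤ d) (y : SS d) (g : SS d → ℝ) (hg : Continuous g) :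
    Tendsto (fun n : ℕ => ∫ p : SS d, tau d n * uu (p : EE d) y ^ n * g p ∂(sig d)) atTop
      (𝓝 ((d : ℝ) / 2 * g y)) := by
  have h : (3:ℝ) ≤ d := by exact_mod_cast hd
  have key := tendsto_setIntegral_pow_smul_of_unique_maximum_of_isCompact_of_measure_nhdsWithin_pos
    (μ := sig d) (s := (Set.univ : Set (SS d))) (x₀ := y) (g := g)
    (c := fun p : SS d => uu (p : EE d) y) isCompact_univ
    (fun u hu hy => by rw [Set.inter_univ]; exact hu.measure_pos _ ⟨y, hy⟩)
    (uu_cont _).continuousOn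
    (fun p _ hp => by rw [uu_self]; exact uu_lt y p hp)
    (fun p _ => (uu_mem' p y).1) (by simp only [uu_self]; norm_num) (Set.mem_univ _)
    (by rw [integrableOn_univ]; exact integrable_of_cont _ hg) hg.continuousWithinAt
  simp only [Measure.restrict_univ, smul_eq_mul] at key
  refine (key.const_mul ((d:ℝ)/2)).congr' ?_
  filter_upwards [eventually_ge_atTop 1] with n hn
  obtain ⟨k, rfl⟩ : ∃ k, n = k + 1 := ⟨n - 1, by omega⟩
  rw [moment hd, ← tau_mm hd k]
  have := mm_pos hd k
  simp only [mul_assoc]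
  rw [integral_const_mul]
  field_simp

/-- Key convolution identity. -/
lemma conv_id {d : ℕ} (hd : 3 ≤ d) (x y : SS d) (K K' K'' : ℝ → ℝ)
    (hK : ∀ u ∈ Set.Icc (0:ℝ) 1, HasDerivAt K (K' u) u)
    (hK' : ∀ u ∈ Set.Icc (0:ℝ) 1, HasDerivAt K' (K'' u) u)
    (hK'' : ContinuousOn K'' (Set.Icc 0 1)) (φ : ℝ → ℝ)
    (hφ : ∀ u, φ u = 1 - (u * (1 - u) * K'' u + (d:ℝ) / 2 * (1 - 2 * u) * K' u) / ((d:ℝ) / 2)) :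
    Integrable (fun p : SS d => Gt d (uu (p : EE d) y) * φ (uu (p : EE d) x)) (sig d) ∧
    ∫ p : SS d, Gt d (uu (p : EE d) y) * φ (uu (p : EE d) x) ∂(sig d) =
      K (uu (y : EE d) x) - ∫ p : SS d, K (uu (p : EE d) x) ∂(sig d) := by
  have h : (3:ℝ) ≤ d := by exact_mod_cast hd
  have cK : ContinuousOn K (Set.Icc 0 1) := fun u hu => (hK u hu).continuousAt.continuousWithinAt
  have cK' : ContinuousOn K' (Set.Icc 0 1) := fun u hu => (hK' u hu).continuousAt.continuousWithinAt
  have cφ : ContinuousOn φ (Set.Icc 0 1) := by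
    have : φ = fun u => 1 - (u * (1 - u) * K'' u + (d:ℝ) / 2 * (1 - 2 * u) * K' u) / ((d:ℝ) / 2) :=
      funext hφ
    rw [this]
    fun_prop
  have cx := comp_uu_cont x cφ
  have cy := uu_cont (y : EE d)
  have cKx := comp_uu_cont x cK
  obtain ⟨C, hC⟩ := bdd_of_cont _ cx
  have hCnn : 0 ≤ C := (norm_nonneg _).trans (hC x)
  let F : ℕ → SS d → ℝ := fun k p =>
    aa d k * (uu (p : EE d) y ^ (k + 1) - mm d k) * φ (uu (p : EE d) x)
  have cF : ∀ k, Continuous (F k) := fun k =>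
    (continuous_const.mul ((cy.pow _).sub continuous_const)).mul cx
  have hFi : ∀ k, Integrable (F k) (sig d) := fun k => integrable_of_cont _ (cF k)
  have hbd : ∀ k, ∫ p, ‖F k p‖ ∂(sig d) ≤ 2 * C * (aa d k * mm d k) := by
    intro k
    have hb : ∀ p, ‖F k p‖ ≤ aa d k * (uu (p : EE d) y ^ (k + 1) + mm d k) * C := by
      intro p
      simp only [F, norm_mul, Real.norm_eq_abs (aa d k), abs_of_pos (aa_pos hd k)]
      have h1 := aa_pos hd k
      have h2 := mm_pos hd k
      have h3 := pow_nonneg (uu_mem' p y).1 (k + 1)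
      gcongr
      · rw [Real.norm_eq_abs, abs_le]
        constructor <;> linarith
      · exact hC p
    have c1 : Continuous (fun p : SS d => aa d k * (uu (p : EE d) y ^ (k + 1) + mm d k) * C) := by
      fun_prop
    calc _ ≤ ∫ p : SS d, aa d k * (uu (p : EE d) y ^ (k + 1) + mm d k) * C ∂(sig d) :=
          integral_mono (hFi k).norm (integrable_of_cont _ c1) hb
      _ = _ := by
          rw [integral_mul_const, integral_const_mul, integral_add, moment hd]
          · simp; ring
          · exact integrable_of_cont _ (cy.pow _)
          · exact integrable_const _
  have hsum : Summable (fun k => ∫ p, ‖F k p‖ ∂(sig d)) :=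
    Summable.of_nonneg_of_le (fun k => integral_nonneg fun p => norm_nonneg _) hbd
      ((summable_aa_mm hd).mul_left _)
  have hF : (fun p : SS d => ∑' k, F k p) =
      fun p : SS d => Gt d (uu (p : EE d) y) * φ (uu (p : EE d) x) := by
    funext p
    simp only [F, Gt]
    rw [tsum_mul_right]
  have hs := hasSum_integral_of_summable_integral_norm hFi hsum
  have hIntg : Integrable (fun p : SS d => ∑' k, F k p) (sig d) := by
    refine ⟨?_, ?_⟩
    · rw [hF]
      refine AEStronglyMeasurable.mul ?_ cx.aestronglyMeasurable
      unfold Gt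
      have : Measurable (fun p : SS d => ∑' k, aa d k * (uu (p : EE d) y ^ (k + 1) - mm d k)) := by
        apply Measurable.tsum
        intro k
        exact (continuous_const.mul ((cy.pow _).sub continuous_const)).measurable
      exact this.aestronglyMeasurable
    · have hle : ∀ p, ‖∑' k, F k p‖ₑ ≤ ∑' k, ‖F k p‖ₑ := fun p => enorm_tsum_le_tsum_enorm
      refine (lintegral_mono hle).trans_lt ?_
      rw [lintegral_tsum (fun k => (hFi k).1.enorm)]
      simp only [← ofReal_integral_norm_eq_lintegral_enorm (hFi _)]
      exact hsum.tsum_ofReal_lt_top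
  rw [hF] at hs hIntg
  refine ⟨hIntg, ?_⟩
  have ht := hs.tendsto_sum_nat
  have e : ∀ n, ∑ k ∈ Finset.range n, ∫ p, F k p ∂(sig d) =
      ((∫ p : SS d, tau d n * uu (p : EE d) y ^ n * K (uu (p : EE d) x) ∂(sig d)) / ((d:ℝ) / 2)
        - ∫ p : SS d, K (uu (p : EE d) x) ∂(sig d)) := by
    intro n
    rw [← integral_finsetSum _ (fun k _ => hFi k)]
    have e1 : ∀ p : SS d, ∑ k ∈ Finset.range n, F k p = Pn d n (uu (p : EE d) y) -
        (Pn d n (uu (p : EE d) y) * (uu (p : EE d) x * (1 - uu (p : EE d) x) * K'' (uu (p : EE d) x)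
      + (d : ℝ) / 2 * (1 - 2 * uu (p : EE d) x) * K' (uu (p : EE d) x))) / ((d:ℝ) / 2) := by
      intro p
      simp only [F, Pn]
      rw [← Finset.sum_mul, hφ]
      ring
    simp only [e1]
    have cP : Continuous (Pn d n) := continuous_iff_continuousAt.2 fun u =>
      (Pn_deriv d n u).continuousAt
    have cPy : Continuous (fun p : SS d => Pn d n (uu (p : EE d) y)) := cP.comp cy
    have cLK : Continuous (fun p : SS d => uu (p : EE d) x * (1 - uu (p : EE d) x) * K'' (uu (p : EE d) x)
      + (d : ℝ) / 2 * (1 - 2 * uu (p : EE d) x) * K' (uu (p : EE d) x)) :=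
      comp_uu_cont x (h := fun u => u * (1 - u) * K'' u + (d:ℝ) / 2 * (1 - 2 * u) * K' u) (by fun_prop)
    rw [integral_sub (integrable_of_cont _ cPy)
      (integrable_of_cont (fun p : SS d => (Pn d n (uu (p : EE d) y) * (uu (p : EE d) x * (1 - uu (p : EE d) x) * K'' (uu (p : EE d) x)
      + (d : ℝ) / 2 * (1 - 2 * uu (p : EE d) x) * K' (uu (p : EE d) x))) / ((d:ℝ) / 2))
        ((cPy.mul cLK).div_const _)), integral_div,
      green_second x y (Pn d n) (Pn1 d n) (Pn2 d n) K K' K'' (fun u _ => Pn_deriv d n u)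
        (fun u _ => Pn1_deriv d n u) (by unfold Pn2; fun_prop) hK hK' hK'']
    simp only [Pn_lap hd]
    have z : ∫ p : SS d, Pn d n (uu (p : EE d) y) ∂(sig d) = 0 := by
      unfold Pn
      rw [integral_finsetSum]
      · apply Finset.sum_eq_zero
        intro k _
        rw [integral_const_mul, integral_sub, moment hd]
        · simp
        · exact integrable_of_cont _ (cy.pow _)
        · exact integrable_const _
      · intro k _
        exact integrable_of_cont _ (continuous_const.mul ((cy.pow _).sub continuous_const))
    rw [z]
    have e2 : ∀ p : SS d, K (uu (p : EE d) x) * ((d:ℝ) / 2 - tau d n * uu (p : EE d) y ^ n) =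
        (d:ℝ) / 2 * K (uu (p : EE d) x) - tau d n * uu (p : EE d) y ^ n * K (uu (p : EE d) x) :=
      fun p => by ring
    simp only [e2]
    rw [integral_sub (integrable_of_cont (fun p : SS d => (d:ℝ) / 2 * K (uu (p : EE d) x))
        (continuous_const.mul cKx))
      (integrable_of_cont (fun p : SS d => tau d n * uu (p : EE d) y ^ n * K (uu (p : EE d) x))
        ((continuous_const.mul (cy.pow _)).mul cKx)), integral_const_mul]
    field_simp
    ring
  simp only [e] at ht
  have ha := ((approx_id hd y _ cKx).div_const ((d:ℝ)/2)).sub_const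
    (∫ p : SS d, K (uu (p : EE d) x) ∂(sig d))
  rw [tendsto_nhds_unique ht ha]
  field_simp

end GreenPol

namespace GreenPol

open Filter Topology

lemma ratio_lim (a b : ℝ) : Tendsto (fun n : ℕ => (a + n) / (b + n)) atTop (𝓝 1) := by
  have := tendsto_add_mul_div_add_mul_atTop_nhds (𝕜 := ℝ) a b 1 (d := 1) one_ne_zero
  simpa using this

lemma summ1_aux {d : ℕ} (hd : 3 ≤ d) {r : ℝ} (hr : 0 < r) (hr1 : r < 1) :
    Summable (fun k : ℕ => aa d k * (((k : ℝ) + 1) * r ^ k)) := by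
  have h : (0:ℝ) < d := by exact_mod_cast (by omega)
  have hp : ∀ k : ℕ, 0 < aa d k * (((k : ℝ) + 1) * r ^ k) := fun k => by
    have := aa_pos hd k; positivity
  refine summable_of_ratio_test_tendsto_lt_one hr1 (Eventually.of_forall fun k => (hp k).ne') ?_
  have e : ∀ k : ℕ, ‖aa d (k+1) * ((((k+1 : ℕ) : ℝ) + 1) * r ^ (k+1))‖ / ‖aa d k * (((k : ℝ) + 1) * r ^ k)‖
      = ((d + (k:ℝ)) / (((d:ℝ) / 2 + 1) + k)) * r := by
    intro k
    rw [Real.norm_of_nonneg (hp _).le, Real.norm_of_nonneg (hp _).le, div_eq_iff (hp k).ne']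
    have h1 := aa_succ hd k
    have h2 : (0:ℝ) < (d:ℝ) / 2 + 1 + k := by positivity
    rw [div_mul_eq_mul_div, div_mul_eq_mul_div, eq_div_iff h2.ne']
    push_cast
    rw [pow_succ]
    linear_combination r ^ k * r * h1
  simp only [e]
  simpa using (ratio_lim (d:ℝ) ((d:ℝ)/2+1)).mul_const r

lemma summ2_aux {d : ℕ} (hd : 3 ≤ d) {r : ℝ} (hr : 0 < r) (hr1 : r < 1) :
    Summable (fun k : ℕ => aa d k * (((k : ℝ) + 1) * (k * r ^ (k - 1)))) := by
  have h : (0:ℝ) < d := by exact_mod_cast (by omega)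
  rw [← summable_nat_add_iff 1]
  simp only [Nat.add_sub_cancel]
  have hp : ∀ k : ℕ, 0 < aa d (k+1) * ((((k+1:ℕ) : ℝ) + 1) * (((k+1:ℕ):ℝ) * r ^ k)) := fun k => by
    have := aa_pos hd (k+1); positivity
  refine summable_of_ratio_test_tendsto_lt_one hr1 (Eventually.of_forall fun k => (hp k).ne') ?_
  have e : ∀ k : ℕ, ‖aa d (k+1+1) * ((((k+1+1:ℕ) : ℝ) + 1) * (((k+1+1:ℕ):ℝ) * r ^ (k+1)))‖ /
      ‖aa d (k+1) * ((((k+1:ℕ) : ℝ) + 1) * (((k+1:ℕ):ℝ) * r ^ k))‖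
      = (((d + 1 : ℝ) + (k:ℝ)) / (((d:ℝ) / 2 + 2) + k)) * ((2 + (k:ℝ)) / (1 + (k:ℝ))) * r := by
    intro k
    rw [Real.norm_of_nonneg (hp _).le, Real.norm_of_nonneg (hp _).le, div_eq_iff (hp k).ne']
    have h1 := aa_succ hd (k+1)
    push_cast at h1 ⊢
    have h2 : (0:ℝ) < (d:ℝ) / 2 + 2 + k := by positivity
    have h3 : (0:ℝ) < (1:ℝ) + k := by positivity
    rw [div_mul_div_comm, div_mul_eq_mul_div, div_mul_eq_mul_div, eq_div_iff (by positivity)]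
    rw [pow_succ]
    linear_combination r ^ k * r * (k+1+1) * (k+1) * h1
  simp only [e]
  simpa using ((ratio_lim ((d:ℝ)+1) ((d:ℝ)/2+2)).mul (ratio_lim 2 1)).mul_const r

lemma bd1 {d : ℕ} (hd : 3 ≤ d) {u r : ℝ} (h : |u| ≤ r) (k : ℕ) :
    ‖aa d k * (((k : ℝ) + 1) * u ^ k)‖ ≤ aa d k * (((k : ℝ) + 1) * r ^ k) := by
  have := aa_pos hd k
  rw [norm_mul, norm_mul, norm_pow, Real.norm_of_nonneg this.le,
    Real.norm_of_nonneg (by positivity : (0:ℝ) ≤ (k:ℝ) + 1), Real.norm_eq_abs]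
  gcongr

lemma bd2 {d : ℕ} (hd : 3 ≤ d) {u r : ℝ} (h : |u| ≤ r) (k : ℕ) :
    ‖aa d k * (((k : ℝ) + 1) * (k * u ^ (k - 1)))‖ ≤ aa d k * (((k : ℝ) + 1) * (k * r ^ (k - 1))) := by
  have := aa_pos hd k
  rw [norm_mul, norm_mul, norm_mul, norm_pow, Real.norm_of_nonneg this.le,
    Real.norm_of_nonneg (by positivity : (0:ℝ) ≤ (k:ℝ) + 1),
    Real.norm_of_nonneg (by positivity : (0:ℝ) ≤ (k:ℝ)), Real.norm_eq_abs]
  gcongr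

lemma exists_r {u : ℝ} (h : |u| < 1) : ∃ r, 0 < r ∧ r < 1 ∧ |u| < r :=
  ⟨(1 + |u|) / 2, by positivity, by linarith, by linarith⟩

lemma summ1 {d : ℕ} (hd : 3 ≤ d) {u : ℝ} (h : |u| < 1) :
    Summable (fun k : ℕ => aa d k * (((k : ℝ) + 1) * u ^ k)) := by
  obtain ⟨r, h0, h1, h2⟩ := exists_r h
  exact Summable.of_norm_bounded (summ1_aux hd h0 h1) (bd1 hd h2.le)

lemma summ2 {d : ℕ} (hd : 3 ≤ d) {u : ℝ} (h : |u| < 1) :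
    Summable (fun k : ℕ => aa d k * (((k : ℝ) + 1) * (k * u ^ (k - 1)))) := by
  obtain ⟨r, h0, h1, h2⟩ := exists_r h
  exact Summable.of_norm_bounded (summ2_aux hd h0 h1) (bd2 hd h2.le)

/-- First derivative of `Gt`. -/
noncomputable def F1 (d : ℕ) (u : ℝ) : ℝ := ∑' k : ℕ, aa d k * (((k : ℝ) + 1) * u ^ k)
/-- Second derivative of `Gt`. -/
noncomputable def F2 (d : ℕ) (u : ℝ) : ℝ := ∑' k : ℕ, aa d k * (((k : ℝ) + 1) * (k * u ^ (k - 1)))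

lemma Gt_deriv {d : ℕ} (hd : 3 ≤ d) {u : ℝ} (h : |u| < 1) : HasDerivAt (Gt d) (F1 d u) u := by
  obtain ⟨r, h0, h1, h2⟩ := exists_r h
  unfold Gt F1
  refine hasDerivAt_tsum_of_isPreconnected (summ1_aux hd h0 h1) Metric.isOpen_ball
    (convex_ball (0:ℝ) r).isPreconnected (y₀ := 0)
    (fun n y _ => ((hasDerivAt_pow1 n y).sub_const _).const_mul _)
    (fun n y hy => bd1 hd (by simpa using (Metric.mem_ball.1 hy).le) n) (by simpa using h0) ?_ (by simpa using h2)
  have := (summable_aa_mm hd).neg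
  refine this.congr fun k => ?_
  simp

lemma F1_deriv {d : ℕ} (hd : 3 ≤ d) {u : ℝ} (h : |u| < 1) : HasDerivAt (F1 d) (F2 d u) u := by
  obtain ⟨r, h0, h1, h2⟩ := exists_r h
  unfold F1 F2
  exact hasDerivAt_tsum_of_isPreconnected (summ2_aux hd h0 h1) Metric.isOpen_ball
    (convex_ball (0:ℝ) r).isPreconnected (y₀ := 0)
    (fun n y _ => ((hasDerivAt_pow n y).const_mul _).const_mul _)
    (fun n y hy => bd2 hd (by simpa using (Metric.mem_ball.1 hy).le) n) (by simpa using h0)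
    (summ1 hd (by simp)) (by simpa using h2)

lemma F2_cont {d : ℕ} (hd : 3 ≤ d) {r : ℝ} (h0 : 0 < r) (h1 : r < 1) :
    ContinuousOn (F2 d) (Set.Icc (-r) r) := by
  unfold F2
  exact continuousOn_tsum (fun k => by fun_prop) (summ2_aux hd h0 h1)
    (fun k u hu => bd2 hd (abs_le.2 hu) k)

lemma abs_lt_one' {u : ℝ} (h0 : 0 ≤ u) (h1 : u < 1) : |u| < 1 := by rwa [abs_of_nonneg h0]

lemma F2_mono {d : ℕ} (hd : 3 ≤ d) {u v : ℝ} (h0 : 0 ≤ u) (h : u ≤ v) (h1 : v < 1) :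
    F2 d u ≤ F2 d v := by
  unfold F2
  refine Summable.tsum_le_tsum (fun k => ?_) (summ2 hd (abs_lt_one' h0 (h.trans_lt h1)))
    (summ2 hd (abs_lt_one' (h0.trans h) h1))
  have := aa_pos hd k
  gcongr

lemma F2_nonneg {d : ℕ} (hd : 3 ≤ d) {u : ℝ} (h0 : 0 ≤ u) : 0 ≤ F2 d u :=
  tsum_nonneg fun k => by have := aa_pos hd k; positivity

lemma F1_nonneg {d : ℕ} (hd : 3 ≤ d) {u : ℝ} (h0 : 0 ≤ u) : 0 ≤ F1 d u :=
  tsum_nonneg fun k => by have := aa_pos hd k; positivity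

lemma F1_pos {d : ℕ} (hd : 3 ≤ d) {u : ℝ} (h0 : 0 ≤ u) (h1 : u < 1) : 0 < F1 d u := by
  refine Summable.tsum_pos (summ1 hd (abs_lt_one' h0 h1)) (fun k => ?_) 0 ?_
  · have := aa_pos hd k; positivity
  · simp [aa_zero]

lemma ode {d : ℕ} (hd : 3 ≤ d) {u : ℝ} (h : |u| < 1) :
    u * (1 - u) * F2 d u + (d:ℝ) / 2 * (1 - 2 * u) * F1 d u = (d:ℝ) / 2 := by
  have t1 : Tendsto (fun n => Pn1 d n u) atTop (𝓝 (F1 d u)) := (summ1 hd h).hasSum.tendsto_sum_nat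
  have t2 : Tendsto (fun n => Pn2 d n u) atTop (𝓝 (F2 d u)) := (summ2 hd h).hasSum.tendsto_sum_nat
  have t3 : Tendsto (fun n => tau d n * u ^ n) atTop (𝓝 0) := by
    have a1 := (summ1 hd h).tendsto_atTop_zero.const_mul ((d:ℝ)/2)
    have a2 := (summ2 hd h).tendsto_atTop_zero.const_mul u
    have := a2.add a1
    simp only [mul_zero, add_zero] at this
    refine this.congr fun k => ?_
    unfold tau
    rcases k with _ | k
    · simp; ring
    · simp only [Nat.add_sub_cancel, pow_succ]; ring
  have l := (t2.const_mul (u * (1 - u))).add (t1.const_mul ((d:ℝ) / 2 * (1 - 2 * u)))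
  simp only [Pn_lap hd] at l
  have r := t3.const_sub ((d:ℝ)/2)
  rw [sub_zero] at r
  exact tendsto_nhds_unique l r

lemma mono_of_deriv {f f' : ℝ → ℝ} {a b : ℝ} (hab : a ≤ b)
    (hf : ∀ u ∈ Set.Icc a b, HasDerivAt f (f' u) u) (h : ∀ u ∈ Set.Icc a b, 0 ≤ f' u) :
    f a ≤ f b := by
  have := monotoneOn_of_deriv_nonneg (convex_Icc a b) (f := f)
    (fun u hu => (hf u hu).continuousAt.continuousWithinAt)
    (fun u hu => (hf u (interior_subset hu)).differentiableAt.differentiableWithinAt)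
    (fun u hu => by rw [(hf u (interior_subset hu)).deriv]; exact h u (interior_subset hu))
  exact this (Set.left_mem_Icc.2 hab) (Set.right_mem_Icc.2 hab) hab

/-- Weighted derivative. -/
noncomputable def Qf (d : ℕ) (u : ℝ) : ℝ := (u * (1 - u)) ^ ((d:ℝ)/2) * F1 d u

lemma Qf_deriv {d : ℕ} (hd : 3 ≤ d) {u : ℝ} (h0 : 0 < u) (h1 : u < 1) :
    HasDerivAt (Qf d) ((d:ℝ) / 2 * (u * (1 - u)) ^ ((d:ℝ)/2 - 1)) u := by
  have hp : 0 < u * (1 - u) := mul_pos h0 (by linarith)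
  have a : HasDerivAt (fun u : ℝ => u * (1 - u)) (1 - 2 * u) u := by
    have := (hasDerivAt_id' u).mul ((hasDerivAt_id' u).const_sub 1)
    exact this.congr_deriv (by ring)
  have b := (a.rpow_const (p := (d:ℝ)/2) (Or.inl hp.ne')).mul (F1_deriv hd (abs_lt_one' h0.le h1))
  refine b.congr_deriv ?_
  have o := ode hd (abs_lt_one' h0.le h1)
  have e : (u * (1 - u)) ^ ((d:ℝ)/2) = (u * (1 - u)) ^ ((d:ℝ)/2 - 1) * (u * (1 - u)) := by
    rw [Real.rpow_sub_one hp.ne', div_mul_cancel₀ _ hp.ne']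
  rw [e]
  linear_combination (u * (1 - u)) ^ ((d:ℝ)/2 - 1) * o

lemma Qf_ge {d : ℕ} (hd : 3 ≤ d) {w : ℝ} (h0 : 1 / 2 ≤ w) (h1 : w < 1) : Qf d (1/2) ≤ Qf d w := by
  refine mono_of_deriv h0 (fun u hu => Qf_deriv hd (by linarith [hu.1]) (by linarith [hu.2])) ?_
  intro u hu
  have : 0 ≤ u * (1 - u) := mul_nonneg (by linarith [hu.1]) (by linarith [hu.2])
  positivity

lemma Qf_le {d : ℕ} (hd : 3 ≤ d) {w : ℝ} (h0 : 1 / 2 ≤ w) (h1 : w < 1) :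
    Qf d w ≤ Qf d (1/2) + (d:ℝ)/2 := by
  have h : (3:ℝ) ≤ d := by exact_mod_cast hd
  have := mono_of_deriv (f := fun u => (d:ℝ)/2 * u - Qf d u) h0
    (fun u hu => ((hasDerivAt_id' u).const_mul ((d:ℝ)/2)).sub
      (Qf_deriv hd (by linarith [hu.1]) (by linarith [hu.2]))) ?_
  · nlinarith
  · intro u hu
    have a : 0 ≤ u * (1 - u) := mul_nonneg (by linarith [hu.1]) (by linarith [hu.2])
    have a1 : u * (1 - u) ≤ 1 := by nlinarith [hu.1, hu.2]
    have := Real.rpow_le_one a a1 (by linarith : (0:ℝ) ≤ (d:ℝ)/2 - 1)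
    nlinarith

lemma q_pos {d : ℕ} (hd : 3 ≤ d) : 0 < Qf d (1/2) :=
  mul_pos (Real.rpow_pos_of_pos (by norm_num) _) (F1_pos hd (by norm_num) (by norm_num))

lemma F1_ge {d : ℕ} (hd : 3 ≤ d) {w : ℝ} (h0 : 1 / 2 ≤ w) (h1 : w < 1) :
    Qf d (1/2) * (1 - w) ^ (-((d:ℝ)/2)) ≤ F1 d w := by
  have a := Qf_ge hd h0 h1
  have p : 0 < 1 - w := by linarith
  have hF := F1_pos hd (by linarith) h1
  rw [Real.rpow_neg p.le, ← div_eq_mul_inv, div_le_iff₀ (Real.rpow_pos_of_pos p _)]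
  refine a.trans ?_
  unfold Qf
  rw [mul_comm]
  have : w * (1 - w) ≤ 1 - w := by nlinarith
  have : (w * (1 - w)) ^ ((d:ℝ)/2) ≤ (1 - w) ^ ((d:ℝ)/2) :=
    Real.rpow_le_rpow (mul_nonneg (by linarith) p.le) this (by positivity)
  gcongr

lemma F1_le {d : ℕ} (hd : 3 ≤ d) {w : ℝ} (h0 : 1 / 2 ≤ w) (h1 : w < 1) :
    F1 d w ≤ (Qf d (1/2) + (d:ℝ)/2) * 2 ^ ((d:ℝ)/2) * (1 - w) ^ (-((d:ℝ)/2)) := by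
  have a := Qf_le hd h0 h1
  have p : 0 < 1 - w := by linarith
  have hF := F1_pos hd (by linarith) h1
  rw [Real.rpow_neg p.le, ← div_eq_mul_inv, le_div_iff₀ (Real.rpow_pos_of_pos p _)]
  have : (1 - w) ≤ 2 * (w * (1 - w)) := by nlinarith
  have : (1 - w) ^ ((d:ℝ)/2) ≤ (2 * (w * (1 - w))) ^ ((d:ℝ)/2) :=
    Real.rpow_le_rpow p.le this (by positivity)
  rw [Real.mul_rpow (by norm_num) (mul_nonneg (by linarith) p.le)] at this
  have h2 : (0:ℝ) < 2 ^ ((d:ℝ)/2) := by positivity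
  calc _ ≤ F1 d w * (2 ^ ((d:ℝ)/2) * (w * (1 - w)) ^ ((d:ℝ)/2)) := by gcongr
    _ = Qf d w * 2 ^ ((d:ℝ)/2) := by unfold Qf; ring
    _ ≤ _ := by gcongr

lemma Gt_ge {d : ℕ} (hd : 3 ≤ d) {w : ℝ} (h0 : 1 / 2 ≤ w) (h1 : w < 1) :
    Qf d (1/2) / ((d:ℝ)/2 - 1) * (1 - w) ^ (1 - (d:ℝ)/2) +
      (Gt d (1/2) - Qf d (1/2) / ((d:ℝ)/2 - 1) * (1/2) ^ (1 - (d:ℝ)/2)) ≤ Gt d w := by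
  have h : (3:ℝ) ≤ d := by exact_mod_cast hd
  have hm : (0:ℝ) < (d:ℝ)/2 - 1 := by linarith
  have key := mono_of_deriv (f := fun u => Gt d u - Qf d (1/2) / ((d:ℝ)/2 - 1) * (1 - u) ^ (1 - (d:ℝ)/2))
    (f' := fun u => F1 d u - Qf d (1/2) * (1 - u) ^ (-((d:ℝ)/2))) h0 ?_ ?_
  · norm_num at key ⊢
    linarith
  · intro u hu
    have p : 0 < 1 - u := by linarith [hu.2]
    have a := (((hasDerivAt_id' u).const_sub 1).rpow_const (p := 1 - (d:ℝ)/2) (Or.inl p.ne')).const_mul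
      (Qf d (1/2) / ((d:ℝ)/2 - 1))
    refine ((Gt_deriv hd (abs_lt_one' (by linarith [hu.1]) (by linarith))).sub a).congr_deriv ?_
    have e : 1 - (d:ℝ)/2 - 1 = -((d:ℝ)/2) := by ring
    rw [e]
    have e2 : Qf d (1/2) / ((d:ℝ)/2 - 1) * (-1 * (1 - (d:ℝ)/2) * (1 - u) ^ (-((d:ℝ)/2))) =
        Qf d (1/2) / ((d:ℝ)/2 - 1) * ((d:ℝ)/2 - 1) * (1 - u) ^ (-((d:ℝ)/2)) := by ring
    rw [e2, div_mul_cancel₀ _ hm.ne']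
  · intro u hu
    have := F1_ge hd hu.1 (by linarith [hu.2])
    linarith

lemma patch {f g : ℝ → ℝ} {a f' : ℝ} (hf : HasDerivAt f f' a) (hg : HasDerivAt g f' a)
    (h : f a = g a) : HasDerivAt (fun u => if u ≤ a then f u else g u) f' a := by
  rw [← hasDerivWithinAt_univ, ← Set.Iic_union_Ici (a := a)]
  apply HasDerivWithinAt.union
  · refine hf.hasDerivWithinAt.congr (fun u hu => ?_) ?_
    · simp only [Set.mem_Iic] at hu
      simp [hu]
    · simp
  · refine hg.hasDerivWithinAt.congr (fun u hu => ?_) ?_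
    · simp only [Set.mem_Ici] at hu
      rcases hu.eq_or_lt with e | e
      · subst e; simp [h]
      · simp [not_le.2 e]
    · simp [h]

lemma patch_all {f g f' g' : ℝ → ℝ} {a : ℝ} {u : ℝ} (hf : u ≤ a → HasDerivAt f (f' u) u)
    (hg : a ≤ u → HasDerivAt g (g' u) u) (h : f a = g a) (h' : f' a = g' a) :
    HasDerivAt (fun u => if u ≤ a then f u else g u) (if u ≤ a then f' u else g' u) u := by
  rcases lt_trichotomy u a with l | l | l
  · rw [if_pos l.le]
    refine (hf l.le).congr_of_eventuallyEq ?_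
    filter_upwards [Iio_mem_nhds l] with v hv
    simp [(Set.mem_Iio.1 hv).le]
  · subst l
    rw [if_pos le_rfl]
    exact patch (hf le_rfl) (h' ▸ hg le_rfl) h
  · rw [if_neg (not_le.2 l)]
    refine (hg l.le).congr_of_eventuallyEq ?_
    filter_upwards [Ioi_mem_nhds l] with v hv
    simp [not_le.2 (Set.mem_Ioi.1 hv)]

lemma trunc {d : ℕ} (hd : 3 ≤ d) {w : ℝ} (h0 : 1 / 2 ≤ w) (h1 : w < 1) :
    ∃ K K' K'' φ : ℝ → ℝ,
      (∀ u ∈ Set.Icc (0:ℝ) 1, HasDerivAt K (K' u) u) ∧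
      (∀ u ∈ Set.Icc (0:ℝ) 1, HasDerivAt K' (K'' u) u) ∧
      ContinuousOn K'' (Set.Icc 0 1) ∧
      (∀ u, φ u = 1 - (u * (1 - u) * K'' u + (d:ℝ) / 2 * (1 - 2 * u) * K' u) / ((d:ℝ) / 2)) ∧
      (∀ u, u ≤ w → K u = Gt d u) ∧
      (∀ u, 0 ≤ u → u < 1 → K u ≤ Gt d u) ∧
      (∀ u, 0 ≤ u → u ≤ w → φ u = 0) ∧
      (∀ u, 0 ≤ u → u ≤ 1 → 0 ≤ φ u) ∧
      (∀ u, 0 ≤ u → u ≤ 1 → φ u ≤ (1 + d) * (1 + F1 d w)) ∧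
      Gt d w ≤ K 1 := by
  have h : (3:ℝ) ≤ d := by exact_mod_cast hd
  have hw0 : 0 ≤ w := by linarith
  have g1 := F1_nonneg hd hw0
  have g2 := F2_nonneg hd hw0
  have ow := ode hd (abs_lt_one' hw0 h1)
  set g : ℝ → ℝ := fun u => Gt d w + F1 d w * (u - w) + F2 d w / 2 * (u - w) ^ 2 with hg
  set g' : ℝ → ℝ := fun u => F1 d w + F2 d w * (u - w) with hg'
  have dg : ∀ u, HasDerivAt g (g' u) u := by
    intro u
    have a := (hasDerivAt_id' u).sub_const w
    have := ((a.const_mul (F1 d w)).const_add (Gt d w)).add ((a.pow 2).const_mul (F2 d w / 2))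
    refine this.congr_deriv ?_
    simp [hg']; ring
  have dg' : ∀ u, HasDerivAt g' (F2 d w) u := by
    intro u
    have a := (hasDerivAt_id' u).sub_const w
    refine ((a.const_mul (F2 d w)).const_add (F1 d w)).congr_deriv (by simp)
  have eg : Gt d w = g w := by simp [hg]
  have eg' : F1 d w = g' w := by simp [hg']
  have hlow : ∀ u, 0 ≤ u → u ≤ w → |u| < 1 := fun u a b => abs_lt_one' a (by linarith)
  refine ⟨fun u => if u ≤ w then Gt d u else g u, fun u => if u ≤ w then F1 d u else g' u,
    fun u => if u ≤ w then F2 d u else F2 d w,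
    fun u => 1 - (u * (1 - u) * (if u ≤ w then F2 d u else F2 d w) +
      (d:ℝ) / 2 * (1 - 2 * u) * (if u ≤ w then F1 d u else g' u)) / ((d:ℝ) / 2),
    ?_, ?_, ?_, fun u => rfl, ?_, ?_, ?_, ?_, ?_, ?_⟩
  · intro u hu
    exact patch_all (fun a => Gt_deriv hd (hlow u hu.1 a)) (fun _ => dg u) eg eg'
  · intro u hu
    exact patch_all (f' := F2 d) (g' := fun _ => F2 d w)
      (fun a => F1_deriv hd (hlow u hu.1 a)) (fun _ => dg' u) eg' rfl
  · have : (fun u => if u ≤ w then F2 d u else F2 d w) = fun u => F2 d (min u w) := by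
      funext u
      split_ifs with c
      · rw [min_eq_left c]
      · rw [min_eq_right (not_le.1 c).le]
    rw [this]
    refine (F2_cont hd (r := w) (by linarith) h1).comp (by fun_prop) ?_
    intro u hu
    exact ⟨le_min (by linarith [hu.1]) (by linarith), min_le_right _ _⟩
  · intro u hu
    simp [hu]
  · intro u a b
    simp only
    split_ifs with c
    · exact le_rfl
    · have c := (not_le.1 c).le
      have k1 : ∀ v, w ≤ v → v ≤ u → g' v ≤ F1 d v := by
        intro v hv hv'
        have := mono_of_deriv (f := fun v => F1 d v - g' v) hv
          (fun t ht => (F1_deriv hd (abs_lt_one' (by linarith [ht.1]) (by linarith [ht.2]))).sub (dg' t))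
          (fun t ht => by
            have := F2_mono hd hw0 ht.1 (by linarith [ht.2])
            linarith)
        simp only [← eg'] at this
        linarith
      have := mono_of_deriv (f := fun v => Gt d v - g v) c
          (fun t ht => (Gt_deriv hd (abs_lt_one' (by linarith [ht.1]) (by linarith [ht.2]))).sub (dg t))
          (fun t ht => by
            have := k1 t ht.1 ht.2
            linarith)
      simp only [← eg] at this
      linarith
  · intro u a b
    simp only [if_pos b]
    rw [ode hd (hlow u a b), div_self (by positivity), sub_self]
  · intro u a b
    simp only
    split_ifs with c
    · rw [ode hd (hlow u a c), div_self (by positivity), sub_self]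
    · have c := (not_le.1 c).le
      rw [sub_nonneg, div_le_one (by positivity)]
      have e1 : u * (1 - u) ≤ w * (1 - w) := by nlinarith
      have e2 : u * (1 - u) * F2 d w ≤ w * (1 - w) * F2 d w := by gcongr
      have e3 : F1 d w ≤ g' u := by
        have : 0 ≤ F2 d w * (u - w) := mul_nonneg g2 (by linarith)
        simp only [hg']; linarith
      have e4 : (2 * w - 1) * F1 d w ≤ (2 * u - 1) * g' u := by
        apply mul_le_mul (by linarith) e3 g1 (by linarith)
      have e5 : (d:ℝ) / 2 * ((2 * w - 1) * F1 d w) ≤ (d:ℝ) / 2 * ((2 * u - 1) * g' u) := by gcongr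
      linarith
  · intro u a b
    simp only
    split_ifs with c
    · rw [ode hd (hlow u a c), div_self (by positivity), sub_self]
      positivity
    · have c := (not_le.1 c).le
      have e0 : 0 ≤ u * (1 - u) * F2 d w := mul_nonneg (mul_nonneg a (by linarith)) g2
      have e1 : (1 - w) * F2 d w ≤ d * (1 + F1 d w) := by
        have : (2 * w - 1) * F1 d w ≤ 1 * F1 d w := by gcongr; linarith
        have : (d:ℝ) / 2 * ((2 * w - 1) * F1 d w) ≤ (d:ℝ) / 2 * (1 * F1 d w) := by gcongr
        have : 1 / 2 * ((1 - w) * F2 d w) ≤ w * ((1 - w) * F2 d w) := by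
          have : 0 ≤ (1 - w) * F2 d w := mul_nonneg (by linarith) g2
          gcongr
        linarith
      have e2 : g' u ≤ F1 d w + d * (1 + F1 d w) := by
        have : F2 d w * (u - w) ≤ F2 d w * (1 - w) := by gcongr
        simp only [hg']; linarith
      have e2' : 0 ≤ g' u := add_nonneg g1 (mul_nonneg g2 (by linarith))
      have e3 : (2 * u - 1) * g' u ≤ g' u := by nlinarith
      have e4 : u * (1 - u) * F2 d w / ((d:ℝ)/2) ≥ 0 := by positivity
      have e5 : (u * (1 - u) * F2 d w + (d:ℝ) / 2 * (1 - 2 * u) * g' u) / ((d:ℝ) / 2) =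
        u * (1 - u) * F2 d w / ((d:ℝ)/2) - (2 * u - 1) * g' u := by field_simp; ring
      rw [e5]
      linarith
  · simp only [if_neg (not_le.2 h1), hg]
    have : 0 ≤ F1 d w * (1 - w) := mul_nonneg g1 (by linarith)
    have : 0 ≤ F2 d w / 2 * (1 - w) ^ 2 := by positivity
    linarith

end GreenPol

namespace GreenPol

open Filter Topology

lemma int_Gt {d : ℕ} (hd : 3 ≤ d) (y : SS d) :
    Integrable (fun p : SS d => Gt d (uu (p : EE d) y)) (sig d) ∧
      ∫ p : SS d, Gt d (uu (p : EE d) y) ∂(sig d) = 0 := by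
  have := conv_id hd y y (fun _ => 0) (fun _ => 0) (fun _ => 0) (fun u _ => hasDerivAt_const u 0)
    (fun u _ => hasDerivAt_const u 0) continuousOn_const (fun _ => 1) (fun u => by simp)
  simpa using this

lemma sig_singleton {d : ℕ} (hd : 3 ≤ d) (y : SS d) : sig d {y} = 0 := by
  have h : (3:ℝ) ≤ d := by exact_mod_cast hd
  have hle : ∀ k : ℕ, (sig d).real {y} ≤ (d : ℝ) / 2 / (d + k) := by
    intro k
    refine le_trans ?_ (mm_le hd k)
    rw [← moment hd y k, ← integral_indicator_one (measurableSet_singleton y)]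
    refine integral_mono ((integrable_const 1).indicator (measurableSet_singleton y))
      (integrable_of_cont _ ((uu_cont _).pow _)) fun p => ?_
    by_cases hp : p = y
    · subst hp; simp [uu_self]
    · simp only [Set.indicator, Set.mem_singleton_iff, hp, if_false]
      exact pow_nonneg (uu_mem' p y).1 _
  have ht : Tendsto (fun k : ℕ => (d : ℝ) / 2 / (d + k)) atTop (𝓝 0) := by
    apply Tendsto.div_atTop tendsto_const_nhds
    exact tendsto_atTop_add_const_left _ _ tendsto_natCast_atTop_atTop
  have h0 : (sig d).real {y} ≤ 0 := ge_of_tendsto' ht hle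
  have h1 := le_antisymm h0 measureReal_nonneg
  rwa [measureReal_eq_zero_iff] at h1

lemma mean_le {d : ℕ} (hd : 3 ≤ d) (y : SS d) (K : ℝ → ℝ) (hc : ContinuousOn K (Set.Icc 0 1))
    (hK : ∀ u, 0 ≤ u → u < 1 → K u ≤ Gt d u) : ∫ p : SS d, K (uu (p : EE d) y) ∂(sig d) ≤ 0 := by
  rw [← (int_Gt hd y).2]
  refine integral_mono_ae (integrable_of_cont _ (comp_uu_cont y hc)) (int_Gt hd y).1 ?_
  have : ∀ᵐ p ∂(sig d), p ≠ y := by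
    rw [ae_iff]; simpa using sig_singleton hd y
  filter_upwards [this] with p hp
  exact hK _ (uu_mem' p y).1 (uu_lt y p hp)

lemma int_phi {d : ℕ} (y : SS d) (K' K'' φ : ℝ → ℝ)
    (hK' : ∀ u ∈ Set.Icc (0:ℝ) 1, HasDerivAt K' (K'' u) u)
    (hK'' : ContinuousOn K'' (Set.Icc 0 1))
    (hφ : ∀ u, φ u = 1 - (u * (1 - u) * K'' u + (d:ℝ) / 2 * (1 - 2 * u) * K' u) / ((d:ℝ) / 2)) :
    ContinuousOn φ (Set.Icc 0 1) ∧ ∫ p : SS d, φ (uu (p : EE d) y) ∂(sig d) = 1 := by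
  have ck : ContinuousOn K' (Set.Icc 0 1) := fun u hu => (hK' u hu).continuousAt.continuousWithinAt
  have cl : ContinuousOn (fun u => (u * (1 - u) * K'' u + (d:ℝ) / 2 * (1 - 2 * u) * K' u)) (Set.Icc 0 1) := by
    fun_prop
  have e : φ = fun u => 1 - (u * (1 - u) * K'' u + (d:ℝ) / 2 * (1 - 2 * u) * K' u) / ((d:ℝ) / 2) :=
    funext hφ
  refine ⟨by rw [e]; exact continuousOn_const.sub (cl.div_const _), ?_⟩
  have g := green_first y y (fun _ => 1) (fun _ => 0) K' K'' (fun u _ => hasDerivAt_const u 1)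
    continuousOn_const hK' hK''
  simp only [one_mul, zero_mul, integral_zero, neg_zero] at g
  have ci := integrable_of_cont _ (comp_uu_cont y cl)
  simp only [hφ]
  rw [integral_sub (integrable_const _) (ci.div_const _), integral_div, g]
  simp

lemma core {d : ℕ} (hd : 3 ≤ d) {N : ℕ} (hN : 1 ≤ N) (X : Fin N → SS d) {w : ℝ} (h0 : 1 / 2 ≤ w)
    (h1 : w < 1) (hsep : ∀ i j, i ≠ j → uu (X i : EE d) (X j) ≤ w)
    (hone : ∀ (p : SS d) i j, w < uu (p : EE d) (X i) → w < uu (p : EE d) (X j) → i = j)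
    {κ : ℝ} (hκ : 0 < κ) (hκM : κ / N * ((1 + d) * (1 + F1 d w)) ≤ 1)
    {P : ℝ} (hP : ∀ p : SS d, P ≤ ∑ j, Gt d (uu (p : EE d) (X j))) :
    P * (1 - κ) ≤ -(κ / N) * ((∑ i, ∑ j, if i = j then 0 else Gt d (uu (X i : EE d) (X j)))
      + N * Gt d w) := by
  have hN' : (0:ℝ) < N := by exact_mod_cast hN
  obtain ⟨K, K', K'', φ, dK, dK', cK'', hφ, kG, kle, φ0, φnn, φle, k1⟩ := trunc hd h0 h1
  have cK : ContinuousOn K (Set.Icc 0 1) := fun u hu => (dK u hu).continuousAt.continuousWithinAt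
  have hIntg := fun i => int_phi (X i) K' K'' φ dK' cK'' hφ
  have cφ := fun i => comp_uu_cont (X i) (hIntg i).1
  have hconv := fun i j => conv_id hd (X i) (X j) K K' K'' dK dK' cK'' φ hφ
  have hG := fun j => int_Gt hd (X j)
  set U : SS d → ℝ := fun p => ∑ j, Gt d (uu (p : EE d) (X j)) with hU
  set S : SS d → ℝ := fun p => ∑ i, φ (uu (p : EE d) (X i)) with hS
  have iS : Integrable S (sig d) := integrable_finsetSum _ fun i _ => integrable_of_cont _ (cφ i)
  have iU : Integrable U (sig d) := integrable_finsetSum _ fun j _ => (hG j).1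
  have eUS : (fun p => U p * S p) = fun p : SS d =>
      ∑ j, ∑ i, Gt d (uu (p : EE d) (X j)) * φ (uu (p : EE d) (X i)) := by
    funext p; simp only [hU, hS, Finset.sum_mul_sum]
  have iUS : Integrable (fun p => U p * S p) (sig d) := by
    rw [eUS]
    exact integrable_finsetSum _ fun j _ => integrable_finsetSum _ fun i _ => (hconv i j).1
  have vS : ∫ p, S p ∂(sig d) = N := by
    simp only [hS]
    rw [integral_finsetSum _ fun i _ => integrable_of_cont _ (cφ i)]
    simp [(hIntg _).2]
  have vU : ∫ p, U p ∂(sig d) = 0 := by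
    simp only [hU]
    rw [integral_finsetSum _ fun i _ => (hG i).1]
    simp [(hG _).2]
  have vUS : ∫ p, U p * S p ∂(sig d) = ∑ j, ∑ i, (K (uu (X j : EE d) (X i)) -
      ∫ p : SS d, K (uu (p : EE d) (X i)) ∂(sig d)) := by
    rw [eUS, integral_finsetSum _ fun j _ => integrable_finsetSum _ fun i _ => (hconv i j).1]
    refine Finset.sum_congr rfl fun j _ => ?_
    rw [integral_finsetSum _ fun i _ => (hconv i j).1]
    exact Finset.sum_congr rfl fun i _ => (hconv i j).2
  have lUS : (∑ i, ∑ j, if i = j then 0 else Gt d (uu (X i : EE d) (X j))) + N * Gt d w ≤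
      ∫ p, U p * S p ∂(sig d) := by
    rw [vUS]
    have : (N : ℝ) * Gt d w = ∑ i : Fin N, ∑ j : Fin N, if i = j then Gt d w else 0 := by simp
    rw [this, ← Finset.sum_add_distrib]
    refine Finset.sum_le_sum fun i _ => ?_
    rw [← Finset.sum_add_distrib]
    refine Finset.sum_le_sum fun j _ => ?_
    have hm := mean_le hd (X j) K cK kle
    by_cases hij : i = j
    · subst hij
      simp only [if_true, uu_self]
      linarith
    · simp only [hij, if_false]
      rw [kG _ (hsep i j hij)]
      linarith
  have hSle : ∀ p, S p ≤ (1 + d) * (1 + F1 d w) := by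
    intro p
    have nn : 0 ≤ (1 + (d:ℝ)) * (1 + F1 d w) := by
      have := F1_nonneg hd (show 0 ≤ w by linarith)
      positivity
    by_cases hex : ∃ i, w < uu (p : EE d) (X i)
    · obtain ⟨i, hi⟩ := hex
      have : S p = φ (uu (p : EE d) (X i)) := by
        refine Finset.sum_eq_single i (fun j _ hj => ?_) (fun hh => absurd (Finset.mem_univ i) hh)
        refine φ0 _ (uu_mem' p (X j)).1 ?_
        by_contra hc
        exact hj (hone p j i (not_le.1 hc) hi)
      rw [this]
      exact φle _ (uu_mem' p (X i)).1 (uu_mem' p (X i)).2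
    · push Not at hex
      have : S p = 0 := Finset.sum_eq_zero fun j _ => φ0 _ (uu_mem' p (X j)).1 (hex j)
      rw [this]; exact nn
  have hψ : ∀ p, 0 ≤ 1 - κ / N * S p := by
    intro p
    have : κ / N * S p ≤ κ / N * ((1 + d) * (1 + F1 d w)) := by
      have := hSle p
      gcongr
    linarith
  have hmain : ∫ p, P * (1 - κ / N * S p) ∂(sig d) ≤ ∫ p, (U p - κ / N * (U p * S p)) ∂(sig d) := by
    refine integral_mono (((integrable_const 1).sub (iS.const_mul _)).const_mul P)
      (iU.sub (iUS.const_mul _)) fun p => ?_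
    have := mul_le_mul_of_nonneg_right (hP p) (hψ p)
    simp only
    calc _ ≤ _ := this
      _ = U p - κ / N * (U p * S p) := by simp only [hU]; ring
  rw [integral_const_mul, integral_sub (integrable_const _) (iS.const_mul _), integral_const_mul, vS,
    integral_sub iU (iUS.const_mul _), integral_const_mul, vU, div_mul_cancel₀ _ hN'.ne'] at hmain
  simp only [integral_const, probReal_univ, smul_eq_mul, mul_one] at hmain
  have := mul_le_mul_of_nonneg_left lUS (by positivity : 0 ≤ κ / N)
  linarith

lemma Gt_lower {d : ℕ} (hd : 3 ≤ d) {u : ℝ} (h0 : 0 ≤ u) : -(∑' k, aa d k * mm d k) ≤ Gt d u := by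
  unfold Gt
  by_cases hs : Summable (fun k : ℕ => aa d k * (u ^ (k + 1) - mm d k))
  · rw [← tsum_neg]
    refine Summable.tsum_le_tsum (fun k => ?_) (summable_aa_mm hd).neg hs
    have : 0 ≤ aa d k * u ^ (k + 1) := mul_nonneg (aa_pos hd k).le (pow_nonneg h0 _)
    linarith
  · rw [tsum_eq_zero_of_not_summable hs, neg_nonpos]
    exact tsum_nonneg fun k => (mul_pos (aa_pos hd k) (mm_pos hd k)).le

/-- Normalizing constant. -/
noncomputable def CC (d : ℕ) : ℝ := 2 / ((d : ℝ) * sphereVol d)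

lemma CC_pos {d : ℕ} (hd : 3 ≤ d) : 0 < CC d := by
  have h : (0:ℝ) < d := by exact_mod_cast (by omega)
  have := Real.Gamma_pos_of_pos (show (0:ℝ) < ((d : ℝ) + 1) / 2 by positivity)
  unfold CC sphereVol
  have := Real.pi_pos
  positivity

lemma green_eq {d : ℕ} {p q : EE d} (hp : ‖p‖ = 1) (hq : ‖q‖ = 1) :
    greenKernel d p q = CC d * Gt d (uu p q) := by
  rw [← uu_eq hp hq]; rfl

end GreenPol

set_option maxHeartbeats 4000000 in
/-- Green polarization upper bound for well-separated
configurations on `𝕊^d`, `d ≥ 3`. -/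
theorem green_main (d : ℕ) (hd : 3 ≤ d) (c₀ : ℝ) (hc₀ : 0 < c₀) :
    ∃ c > 0, ∃ b > 0, ∃ N₀ : ℕ, ∀ N : ℕ, N₀ ≤ N →
      ∀ x : Fin N → EuclideanSpace ℝ (Fin (d + 1)),
        (∀ i, x i ∈ Metric.sphere (0 : EuclideanSpace ℝ (Fin (d + 1))) 1) →
        (∀ i j, i ≠ j → c₀ * (N : ℝ) ^ (-1 / (d : ℝ)) ≤ ‖x i - x j‖) →
        ∀ D : ℝ,
          (∑ i, ∑ j, if i = j then 0 else greenKernel d (x i) (x j)) =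
            -D * (N : ℝ) ^ (2 - 2 / (d : ℝ)) →
          (⨅ p : Metric.sphere (0 : EuclideanSpace ℝ (Fin (d + 1))) 1,
              ∑ j, greenKernel d (p : EuclideanSpace ℝ (Fin (d + 1))) (x j)) ≤
            c * (D - b) * (N : ℝ) ^ (1 - 2 / (d : ℝ)) := by
  have hd3 : (3:ℝ) ≤ d := by exact_mod_cast hd
  have hd0 : (0:ℝ) < d := by linarith
  set c1 : ℝ := min (c₀ ^ 2 / 16) (1 / 2) with hc1
  have c1p : 0 < c1 := lt_min (by positivity) (by norm_num)
  have c1a : c1 ≤ c₀ ^ 2 / 16 := min_le_left _ _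
  have c1b : c1 ≤ 1 / 2 := min_le_right _ _
  set q := GreenPol.Qf d (1/2) with hq
  have qp : 0 < q := GreenPol.q_pos hd
  set A := q / ((d:ℝ)/2 - 1) with hA
  have Ap : 0 < A := div_pos qp (by linarith)
  set B := GreenPol.Gt d (1/2) - A * (1/2) ^ (1 - (d:ℝ)/2) with hB
  set A' := A * c1 ^ (1 - (d:ℝ)/2) with hA'
  have A'p : 0 < A' := mul_pos Ap (Real.rpow_pos_of_pos c1p _)
  set M := (1 + (d:ℝ)) * (1 + (q + (d:ℝ)/2) * 2 ^ ((d:ℝ)/2) * c1 ^ (-((d:ℝ)/2))) with hM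
  have Mp : 0 < M := by
    have := Real.rpow_pos_of_pos c1p (-((d:ℝ)/2))
    positivity
  set κ := min (1/2) (1 / M) with hκ
  have κp : 0 < κ := lt_min (by norm_num) (by positivity)
  have κh : κ ≤ 1/2 := min_le_left _ _
  have κM : κ * M ≤ 1 := by
    have : κ ≤ 1 / M := min_le_right _ _
    rwa [le_div_iff₀ Mp] at this
  have Cp := GreenPol.CC_pos hd
  set C := GreenPol.CC d with hC
  have e1 : (0:ℝ) < 1 - 2 / (d:ℝ) := by
    have : 2 / (d:ℝ) < 1 := by rw [div_lt_one hd0]; linarith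
    linarith
  have hlim : Filter.Tendsto (fun N : ℕ => (N:ℝ) ^ (1 - 2 / (d:ℝ))) Filter.atTop Filter.atTop :=
    (tendsto_rpow_atTop e1).comp tendsto_natCast_atTop_atTop
  obtain ⟨N1, hN1⟩ := Filter.eventually_atTop.1 (hlim.eventually_ge_atTop (-B / (A' / 2)))
  refine ⟨κ / (1 - κ), div_pos κp (by linarith), C * (A' / 2), by positivity, max N1 1, ?_⟩
  intro N hN x hx hsep D hE
  have hNa := hN1 N (le_trans (le_max_left _ _) hN)
  have hNb : 1 ≤ N := le_trans (le_max_right _ _) hN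
  have hNr : (1:ℝ) ≤ N := by exact_mod_cast hNb
  have hN0 : (0:ℝ) < N := by linarith
  have nx : ∀ i, ‖x i‖ = 1 := fun i => by simpa using hx i
  set T : ℝ := (N:ℝ) ^ (-2 / (d:ℝ)) with hT
  have Tp : 0 < T := Real.rpow_pos_of_pos hN0 _
  have T1 : T ≤ 1 := Real.rpow_le_one_of_one_le_of_nonpos hNr (by
    rw [neg_div]; exact neg_nonpos.2 (by positivity))
  have hT2 : ((N:ℝ) ^ (-1 / (d:ℝ))) ^ 2 = T := by
    rw [← Real.rpow_natCast, ← Real.rpow_mul hN0.le, hT]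
    congr 1
    push_cast
    ring
  set ε := c1 * T with hε
  have εp : 0 < ε := mul_pos c1p Tp
  have εh : ε ≤ 1 / 2 := by nlinarith
  have ε1 : ε ^ (1 - (d:ℝ)/2) = c1 ^ (1 - (d:ℝ)/2) * (N:ℝ) ^ (1 - 2 / (d:ℝ)) := by
    rw [hε, Real.mul_rpow c1p.le Tp.le, hT, ← Real.rpow_mul hN0.le]
    congr 2
    field_simp
    ring
  have ε2 : ε ^ (-((d:ℝ)/2)) = c1 ^ (-((d:ℝ)/2)) * N := by
    rw [hε, Real.mul_rpow c1p.le Tp.le, hT, ← Real.rpow_mul hN0.le]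
    have : -2 / (d:ℝ) * -((d:ℝ)/2) = 1 := by field_simp
    rw [this, Real.rpow_one]
  have hw0 : 1 / 2 ≤ 1 - ε := by linarith
  have hw1 : 1 - ε < 1 := by linarith
  have sepsq : ∀ i j, i ≠ j → 16 * ε ≤ ‖x i - x j‖ ^ 2 := by
    intro i j hij
    have h1 := hsep i j hij
    have h2 : (c₀ * (N : ℝ) ^ (-1 / (d : ℝ))) ^ 2 ≤ ‖x i - x j‖ ^ 2 :=
      pow_le_pow_left₀ (by positivity) h1 2
    rw [mul_pow, hT2] at h2
    have : c1 * T ≤ c₀ ^ 2 / 16 * T := by gcongr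
    linarith
  set X : Fin N → GreenPol.SS d := fun i => ⟨x i, hx i⟩ with hX
  have hsep' : ∀ i j, i ≠ j → GreenPol.uu (X i : GreenPol.EE d) (X j) ≤ 1 - ε := by
    intro i j hij
    rw [← GreenPol.uu_eq (GreenPol.ss_norm _) (GreenPol.ss_norm _)]
    have := sepsq i j hij
    simp only [hX]
    linarith
  have hone : ∀ (p : GreenPol.SS d) i j, 1 - ε < GreenPol.uu (p : GreenPol.EE d) (X i) →
      1 - ε < GreenPol.uu (p : GreenPol.EE d) (X j) → i = j := by
    intro p i j hi hj
    by_contra hij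
    rw [← GreenPol.uu_eq (GreenPol.ss_norm _) (GreenPol.ss_norm _)] at hi hj
    simp only [hX] at hi hj
    have s := sepsq i j hij
    have tri : ‖x i - x j‖ ≤ ‖(p : GreenPol.EE d) - x i‖ + ‖(p : GreenPol.EE d) - x j‖ := by
      have := norm_sub_le ((p : GreenPol.EE d) - x j) ((p : GreenPol.EE d) - x i)
      rw [sub_sub_sub_cancel_left] at this
      linarith
    have t2 := pow_le_pow_left₀ (norm_nonneg _) tri 2
    nlinarith [sq_nonneg (‖(p : GreenPol.EE d) - x i‖ - ‖(p : GreenPol.EE d) - x j‖)]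
  have hκM : κ / N * ((1 + d) * (1 + GreenPol.F1 d (1 - ε))) ≤ 1 := by
    have f := GreenPol.F1_le hd hw0 hw1
    rw [sub_sub_cancel, ε2] at f
    have : (1 + (d:ℝ)) * (1 + GreenPol.F1 d (1 - ε)) ≤ M * N := by
      rw [hM, mul_assoc]
      gcongr
      rw [add_mul]
      linarith
    rw [div_mul_eq_mul_div, div_le_one hN0]
    calc κ * ((1 + (d:ℝ)) * (1 + GreenPol.F1 d (1 - ε))) ≤ κ * (M * N) := by gcongr
      _ = κ * M * N := by ring
      _ ≤ 1 * N := by gcongr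
      _ = N := one_mul _
  have hU : ∀ p : GreenPol.SS d, ∑ j, greenKernel d (p : GreenPol.EE d) (x j) =
      C * ∑ j, GreenPol.Gt d (GreenPol.uu (p : GreenPol.EE d) (X j)) := by
    intro p
    rw [Finset.mul_sum]
    exact Finset.sum_congr rfl fun j _ => GreenPol.green_eq (GreenPol.ss_norm p) (nx j)
  have hE' : C * (∑ i, ∑ j, if i = j then 0 else GreenPol.Gt d (GreenPol.uu (X i : GreenPol.EE d) (X j))) =
      -D * (N : ℝ) ^ (2 - 2 / (d : ℝ)) := by
    rw [← hE, Finset.mul_sum]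
    refine Finset.sum_congr rfl fun i _ => ?_
    rw [Finset.mul_sum]
    refine Finset.sum_congr rfl fun j _ => ?_
    split_ifs
    · simp
    · exact (GreenPol.green_eq (nx i) (nx j)).symm
  set P := ⨅ p : Metric.sphere (0 : EuclideanSpace ℝ (Fin (d + 1))) 1,
              ∑ j, greenKernel d (p : EuclideanSpace ℝ (Fin (d + 1))) (x j) with hPdef
  have hPle : ∀ p : GreenPol.SS d, P ≤ ∑ j, greenKernel d (p : GreenPol.EE d) (x j) := by
    intro p
    refine ciInf_le ?_ p
    refine ⟨C * ∑ j : Fin N, -(∑' k, GreenPol.aa d k * GreenPol.mm d k), ?_⟩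
    rintro _ ⟨p, rfl⟩
    simp only
    rw [hU p]
    refine mul_le_mul_of_nonneg_left ?_ Cp.le
    exact Finset.sum_le_sum fun j _ => GreenPol.Gt_lower hd (GreenPol.uu_mem' p (X j)).1
  have hcore := GreenPol.core hd hNb X hw0 hw1 hsep' hone κp hκM (P := P / C) (fun p => by
    rw [div_le_iff₀ Cp, mul_comm, ← hU p]; exact hPle p)
  have hGt := GreenPol.Gt_ge hd hw0 hw1
  rw [sub_sub_cancel, ε1] at hGt
  set R := (N:ℝ) ^ (1 - 2 / (d:ℝ)) with hR
  have hR2 : (N : ℝ) ^ (2 - 2 / (d : ℝ)) = N * R := by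
    rw [hR, ← Real.rpow_one_add' hN0.le (by linarith)]
    congr 1
    ring
  rw [hR2] at hE'
  have hBR : -B ≤ A' / 2 * R := by
    rw [div_le_iff₀ (by positivity)] at hNa
    linarith
  have hG2 : A' / 2 * R ≤ GreenPol.Gt d (1 - ε) := by
    have : A * (c1 ^ (1 - (d:ℝ)/2) * R) = A' * R := by rw [hA']; ring
    rw [← hq, ← hA, this, ← hB] at hGt
    linarith
  set E := ∑ i, ∑ j, if i = j then 0 else GreenPol.Gt d (GreenPol.uu (X i : GreenPol.EE d) (X j)) with hEdef
  have s1 : P * (1 - κ) ≤ κ * (D - C * (A' / 2)) * R := by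
    have a1 := mul_le_mul_of_nonneg_left hcore Cp.le
    have a2 : C * (P / C * (1 - κ)) = P * (1 - κ) := by field_simp
    have a3 : C * (-(κ / N) * (E + N * GreenPol.Gt d (1 - ε))) =
        -(κ / N) * (C * E) - κ * C * GreenPol.Gt d (1 - ε) := by field_simp; ring
    have a4 : -(κ / N) * (-D * (N * R)) = κ * D * R := by field_simp
    rw [a2, a3, hE', a4] at a1
    have a5 : κ * C * (A' / 2 * R) ≤ κ * C * GreenPol.Gt d (1 - ε) := by gcongr
    linarith
  have h1κ : 0 < 1 - κ := by linarith
  calc P ≤ (κ * (D - C * (A' / 2)) * R) / (1 - κ) := by rwa [le_div_iff₀ h1κ]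
    _ = _ := by ring

/-- Green polarization upper bound for well-separated
configurations on `𝕊^d`, `d ≥ 3`. -/
theorem green_polarization_upper_bound (d : ℕ) (hd : 3 ≤ d) (c₀ : ℝ) (hc₀ : 0 < c₀) :
    ∃ c > 0, ∃ b > 0, ∃ N₀ : ℕ, ∀ N : ℕ, N₀ ≤ N →
      ∀ x : Fin N → EuclideanSpace ℝ (Fin (d + 1)),
        (∀ i, x i ∈ Metric.sphere (0 : EuclideanSpace ℝ (Fin (d + 1))) 1) →
        (∀ i j, i ≠ j → c₀ * (N : ℝ) ^ (-1 / (d : ℝ)) ≤ ‖x i - x j‖) →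
        ∀ D : ℝ,
          (∑ i, ∑ j, if i = j then 0 else greenKernel d (x i) (x j)) =
            -D * (N : ℝ) ^ (2 - 2 / (d : ℝ)) →
          (⨅ p : Metric.sphere (0 : EuclideanSpace ℝ (Fin (d + 1))) 1,
              ∑ j, greenKernel d (p : EuclideanSpace ℝ (Fin (d + 1))) (x j)) ≤
            c * (D - b) * (N : ℝ) ^ (1 - 2 / (d : ℝ)) := by
  exact green_main d hd c₀ hc₀
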